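/- arXiv:2604.05916 — 10 statements merged into one kernel-verified Lean document; each statement's English description precedes it below -/
import Mathlib

section
/- For every integer m ≥ 3, the Borda rule never selects a Condorcet loser: for every preference profile ≿ and every alternative x ∈ f^{s^B}(≿), x is not a Condorcet loser at ≿ (equivalently, L(f^{s^B}) = ∅). -/
open Finset

/-- A preference profile over `m` alternatives with `n` voters: voter `i`'s linear
order `≿_i` is encoded by the bijection `P i` sending each alternative to its
0-indexed rank (rank `0` = first, rank `m-1` = last); thus `y ≿_i x` iff
`P i y ≤ P i x`, and the 1-indexed rank is `r(x, ≿_i) = (P i x : ℕ) + 1`. -/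
abbrev Profile (m n : ℕ) := Fin n → (Fin m ≃ Fin m)

/-- `s` is a score vector for `m` alternatives: entries in `[0,1]`, weakly
decreasing, first entry `1`, last entry `0` (index `k : Fin m` corresponds to
the 1-indexed rank `k + 1`). -/
def IsScoreVec {m : ℕ} (s : Fin m → ℝ) : Prop :=
  Antitone s ∧ (∀ k, 0 ≤ s k ∧ s k ≤ 1) ∧
    (∀ k : Fin m, (k : ℕ) = 0 → s k = 1) ∧
    (∀ k : Fin m, (k : ℕ) = m - 1 → s k = 0)

/-- The Borda score vector: 1-indexed, `s^B(k) = (m - k)/(m - 1)`, i.e.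
0-indexed, `k ↦ (m - 1 - k)/(m - 1)`. -/
noncomputable def bordaVec (m : ℕ) : Fin m → ℝ :=
  fun k => ((m : ℝ) - 1 - (k : ℕ)) / ((m : ℝ) - 1)

/-- Total score `∑_{i ∈ N} s(r(x, ≿_i))` of alternative `x` at profile `P`. -/
noncomputable def score {m n : ℕ} (s : Fin m → ℝ) (P : Profile m n) (x : Fin m) : ℝ :=
  ∑ i, s (P i x)

/-- The choice set `f^s(≿)` of the scoring rule with score vector `s`. -/
def winners {m n : ℕ} (s : Fin m → ℝ) (P : Profile m n) : Set (Fin m) :=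
  {x | ∀ y, score s P y ≤ score s P x}

/-- `x` is a Condorcet loser at `P`: for every `y ≠ x`,
`|{i : y ≿_i x}| > |{i : x ≿_i y}|`. -/
def CondorcetLoser {m n : ℕ} (P : Profile m n) (x : Fin m) : Prop :=
  ∀ y, y ≠ x →
    (univ.filter fun i => P i x ≤ P i y).card <
      (univ.filter fun i => P i y ≤ P i x).card

/-- The total 0-indexed rank of `x` over all voters. -/
def totalRank {m n : ℕ} (P : Profile m n) (x : Fin m) : ℕ :=
  ∑ i, (P i x : ℕ)

lemma score_bordaVec {m n : ℕ} (P : Profile m n) (x : Fin m) :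
    score (bordaVec m) P x = (n * ((m : ℝ) - 1) - totalRank P x) / ((m : ℝ) - 1) := by
  simp [score, bordaVec, totalRank, ← Finset.sum_div, Finset.sum_sub_distrib, mul_sub]

lemma totalRank_le_of_mem_winners {m n : ℕ} (hm : 1 < m) {P : Profile m n} {x : Fin m}
    (hx : x ∈ winners (bordaVec m) P) (y : Fin m) : totalRank P x ≤ totalRank P y := by
  have hm' : (0 : ℝ) < (m : ℝ) - 1 := sub_pos.2 (by exact_mod_cast hm)
  have h := hx y
  rw [score_bordaVec, score_bordaVec, div_le_div_iff_of_pos_right hm'] at h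
  exact_mod_cast (sub_le_sub_iff_left _).1 h

lemma sum_totalRank_mul_two {m n : ℕ} (P : Profile m n) :
    (∑ y, totalRank P y) * 2 = n * (m * (m - 1)) := by
  have h (i : Fin n) : ∑ y, (P i y : ℕ) = ∑ k ∈ range m, k := by
    rw [Equiv.sum_comp (P i) (fun k => (k : ℕ)), Fin.sum_univ_eq_sum_range (fun k => k)]
  simp only [totalRank]
  rw [Finset.sum_comm]
  simp only [h, sum_const, card_univ, Fintype.card_fin, smul_eq_mul]
  rw [mul_assoc, sum_range_id_mul_two]

/-- A Borda winner's average rank is at most the overall average rank. -/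
lemma two_mul_totalRank_le_of_mem_winners {m n : ℕ} (hm : 1 < m) {P : Profile m n} {x : Fin m}
    (hx : x ∈ winners (bordaVec m) P) : 2 * totalRank P x ≤ n * (m - 1) := by
  have h : m * totalRank P x ≤ ∑ y, totalRank P y := by
    simpa using Finset.card_nsmul_le_sum univ (totalRank P) (totalRank P x)
      fun y _ => totalRank_le_of_mem_winners hm hx y
  refine le_of_mul_le_mul_left (a := m) ?_ (Nat.zero_lt_of_lt hm)
  calc m * (2 * totalRank P x) = (m * totalRank P x) * 2 := by ring
    _ ≤ (∑ y, totalRank P y) * 2 := by gcongr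
    _ = m * (n * (m - 1)) := by rw [sum_totalRank_mul_two]; ring

lemma sum_card_filter_rank_le {m n : ℕ} (P : Profile m n) (x : Fin m) :
    ∑ y, (univ.filter fun i => P i y ≤ P i x).card = totalRank P x + n := by
  have h (i : Fin n) : (univ.filter fun y => P i y ≤ P i x).card = (P i x : ℕ) + 1 := by
    rw [← Fin.card_Iic, ← Finset.card_map (P i).toEmbedding]
    congr 1
    ext k
    simp [Finset.mem_map_equiv]
  have hswap := Finset.sum_card_bipartiteAbove_eq_sum_card_bipartiteBelow
    (s := univ) (t := univ) (fun i y => P i y ≤ P i x)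
  simp only [bipartiteAbove, bipartiteBelow] at hswap
  rw [← hswap]
  simp [h, totalRank, sum_add_distrib]

lemma sum_card_filter_le_rank {m n : ℕ} (P : Profile m n) (x : Fin m) :
    ∑ y, (univ.filter fun i => P i x ≤ P i y).card + totalRank P x = n * m := by
  have h (i : Fin n) : (univ.filter fun y => P i x ≤ P i y).card + (P i x : ℕ) = m := by
    have hc : (univ.filter fun y => P i x ≤ P i y).card = m - (P i x : ℕ) := by
      rw [← Fin.card_Ici, ← Finset.card_map (P i).toEmbedding]
      congr 1
      ext k
      simp [Finset.mem_map_equiv]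
    have := (P i x).isLt
    omega
  have hswap := Finset.sum_card_bipartiteAbove_eq_sum_card_bipartiteBelow
    (s := univ) (t := univ) (fun i y => P i x ≤ P i y)
  simp only [bipartiteAbove, bipartiteBelow] at hswap
  rw [← hswap]
  simp [totalRank, ← sum_add_distrib, h]

/-- A Condorcet loser's average rank exceeds the overall average rank. -/
lemma CondorcetLoser.lt_two_mul_totalRank {m n : ℕ} (hm : 1 < m) {P : Profile m n} {x : Fin m}
    (hx : CondorcetLoser P x) : n * (m - 1) < 2 * totalRank P x := by
  have hlt : ∑ y, (univ.filter fun i => P i x ≤ P i y).card <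
      ∑ y, (univ.filter fun i => P i y ≤ P i x).card := by
    have : Nontrivial (Fin m) := Fin.nontrivial_iff_two_le.2 hm
    obtain ⟨z, hz⟩ := exists_ne x
    refine Finset.sum_lt_sum (fun y _ => ?_) ⟨z, mem_univ z, hx z hz⟩
    obtain rfl | hy := eq_or_ne y x
    · exact le_rfl
    · exact (hx y hy).le
  have h₁ := sum_card_filter_rank_le P x
  have h₂ := sum_card_filter_le_rank P x
  have hnm : n ≤ n * m := Nat.le_mul_of_pos_right n (Nat.zero_lt_of_lt hm)
  rw [Nat.mul_sub_one]
  omega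

/-- For every `m ≥ 3`, the Borda rule never selects a Condorcet loser. -/
theorem borda_never_selects_condorcet_loser
    (m : ℕ) (hm : 3 ≤ m) (n : ℕ) (hn : 0 < n) (P : Profile m n) (x : Fin m)
    (hx : x ∈ winners (bordaVec m) P) :
    ¬ CondorcetLoser P x := fun hL =>
  have hm' : 1 < m := by omega
  (two_mul_totalRank_le_of_mem_winners hm' hx).not_gt (hL.lt_two_mul_totalRank hm')
end

section
/- For every integer m ≥ 3 and every score vector s that is not the Borda score vector, there exists a preference profile ≿ at which f^s selects a Condorcet loser; that is, L(f^s) ≠ ∅. -/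
open Finset

/-- Reindexing a sum over all permutations moves the second argument to any `z ≠ x`. -/
lemma sum_perm_eq_of_ne {α : Type*} [Fintype α] [DecidableEq α] (h : α → α → ℝ)
    {x y z : α} (hy : y ≠ x) (hz : z ≠ x) :
    ∑ σ : Equiv.Perm α, h (σ x) (σ y) = ∑ σ : Equiv.Perm α, h (σ x) (σ z) := by
  refine Fintype.sum_equiv (Equiv.mulRight (Equiv.swap y z)) _ _ fun σ => ?_
  simp [Equiv.swap_apply_of_ne_of_ne hy.symm hz.symm]

/-- Averaging a function of the image of `x` over all permutations. -/
lemma card_mul_sum_perm {α : Type*} [Fintype α] [DecidableEq α] (g : α → ℝ) (x : α) :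
    (Fintype.card α : ℝ) * ∑ σ : Equiv.Perm α, g (σ x) =
      (Fintype.card (Equiv.Perm α) : ℝ) * ∑ k, g k := by
  have hconst (y : α) : ∑ σ : Equiv.Perm α, g (σ y) = ∑ σ : Equiv.Perm α, g (σ x) := by
    refine Fintype.sum_equiv (Equiv.mulRight (Equiv.swap x y)) _ _ fun σ => ?_
    simp
  have hcomm : ∑ y, ∑ σ : Equiv.Perm α, g (σ y) =
      ∑ σ : Equiv.Perm α, ∑ y, g (σ y) := sum_comm
  simpa [hconst, Equiv.sum_comp] using hcomm

/-- Averaging a function vanishing on the diagonal over the images of two distinct points. -/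
lemma card_mul_sum_perm_pair {α : Type*} [Fintype α] [DecidableEq α] (h : α → α → ℝ)
    (hdiag : ∀ k, h k k = 0) {x y : α} (hy : y ≠ x) :
    (Fintype.card α : ℝ) * (((Fintype.card α : ℝ) - 1) *
        ∑ σ : Equiv.Perm α, h (σ x) (σ y)) =
      (Fintype.card (Equiv.Perm α) : ℝ) * ∑ k, ∑ j, h k j := by
  rw [← card_mul_sum_perm (fun k => ∑ j, h k j) x]
  congr 1
  have hcomm : ∑ σ : Equiv.Perm α, ∑ j, h (σ x) j =
      ∑ z, ∑ σ : Equiv.Perm α, h (σ x) (σ z) :=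
    (sum_congr rfl fun σ _ => (Equiv.sum_comp σ (h (σ x))).symm).trans sum_comm
  rw [hcomm, ← add_sum_erase univ _ (mem_univ x),
    sum_congr rfl fun z hz => sum_perm_eq_of_ne h (ne_of_mem_erase hz) hy]
  have hcard : 1 ≤ Fintype.card α := Fintype.card_pos_iff.2 ⟨x⟩
  simp [hdiag, card_erase_of_mem, Nat.cast_sub hcard]

/-- In `Fin m`, the number of `j ≤ k` minus the number of `j ≥ k` is `2k + 1 - m`. -/
lemma sum_indicator_le_sub {m : ℕ} (k : Fin m) :
    ∑ j : Fin m, ((if j ≤ k then (1 : ℝ) else 0) - if k ≤ j then 1 else 0) =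
      2 * (k : ℕ) + 1 - m := by
  rw [sum_sub_distrib, sum_boole, sum_boole, filter_ge_eq_Iic, filter_le_eq_Ici,
    Fin.card_Iic, Fin.card_Ici, Nat.cast_sub k.2.le]
  push_cast
  ring

/-- A non-Borda score vector admits an integer perturbation of total mass zero which moves
the mean rank strictly down the order without lowering the mean score. -/
lemma exists_int_perturbation {m : ℕ} (hm : 3 ≤ m) {s : Fin m → ℝ} (hs : IsScoreVec s)
    (hsB : s ≠ bordaVec m) :
    ∃ d : Fin m → ℤ, ∑ k, (d k : ℝ) = 0 ∧ 0 < ∑ k, (d k : ℝ) * (k : ℕ) ∧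
      0 ≤ ∑ k, (d k : ℝ) * s k := by
  obtain ⟨i, hi⟩ := Function.ne_iff.1 hsB
  obtain ⟨-, -, hfirst, hlast⟩ := hs
  let a : Fin m := ⟨0, by omega⟩
  let b : Fin m := ⟨m - 1, by omega⟩
  have ha : s a = 1 := hfirst a rfl
  have hb : s b = 0 := hlast b rfl
  have hbv : ((b : ℕ) : ℝ) = m - 1 := by
    simp only [b]
    push_cast [Nat.cast_sub (show 1 ≤ m by omega)]
    ring
  have hm1 : (0 : ℝ) < m - 1 := by
    have : (3 : ℝ) ≤ m := by exact_mod_cast hm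
    linarith
  set c : ℝ := (m - 1) * s i - (m - 1 - (i : ℕ)) with hc
  have hc0 : c ≠ 0 := by
    intro h0
    apply hi
    rw [bordaVec, eq_div_iff hm1.ne']
    linarith
  obtain ⟨t, ht⟩ : ∃ t : ℤ, 1 ≤ (t : ℝ) * c := by
    obtain ⟨t, ht⟩ := exists_int_gt (1 / |c|)
    have h1 : 1 ≤ (t : ℝ) * |c| := ((div_lt_iff₀ (abs_pos.2 hc0)).1 ht).le
    rcases abs_choice c with h | h
    · exact ⟨t, h ▸ h1⟩
    · exact ⟨-t, by rw [h] at h1; push_cast; linarith⟩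
  let d : Fin m → ℤ := fun k =>
    t * ((if k = i then (m - 1 : ℤ) else 0) - (if k = a then (m - 1 - (i : ℕ) : ℤ) else 0)
      - if k = b then ((i : ℕ) : ℤ) else 0) + ((if k = b then 1 else 0) - if k = a then 1 else 0)
  have hd (f : Fin m → ℝ) : ∑ k, (d k : ℝ) * f k =
      t * ((m - 1) * f i - (m - 1 - (i : ℕ)) * f a - (i : ℕ) * f b) + (f b - f a) := by
    simp only [d]
    push_cast
    simp only [add_mul, sub_mul, mul_assoc, sum_add_distrib, sum_sub_distrib, ← mul_sum,
      ite_mul, zero_mul, one_mul, sum_ite_eq', mem_univ, if_true]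
  refine ⟨d, ?_, ?_, ?_⟩
  · have := hd fun _ => 1
    simp only [mul_one] at this
    rw [this]
    ring
  · rw [hd fun k => ((k : ℕ) : ℝ), hbv]
    simp only [a, Nat.cast_zero]
    linarith
  · rw [hd s, ha, hb]
    have : t * ((m - 1) * s i - (m - 1 - (i : ℕ)) * 1 - (i : ℕ) * 0) = t * c := by
      rw [hc]; ring
    linarith

/-- For a non-Borda score vector, some distribution of ranks has mean rank strictly worse
than the middle rank and mean score at least the average score. -/
lemma exists_rank_weights {m : ℕ} (hm : 3 ≤ m) {s : Fin m → ℝ} (hs : IsScoreVec s)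
    (hsB : s ≠ bordaVec m) :
    ∃ w : Fin m → ℕ, 0 < ∑ k, (w k : ℝ) * (2 * (k : ℕ) + 1 - m) ∧
      0 ≤ ∑ k, (w k : ℝ) * ∑ j, (s k - s j) := by
  obtain ⟨d, hd0, hdrank, hdscore⟩ := exists_int_perturbation hm hs hsB
  let M : ℤ := ∑ k, |d k|
  have hw (k : Fin m) : (((M + d k).toNat : ℕ) : ℝ) = M + d k := by
    have hk : |d k| ≤ M := single_le_sum (fun j _ => abs_nonneg (d j)) (mem_univ k)
    have h0 : 0 ≤ M + d k := by linarith [neg_abs_le (d k)]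
    exact_mod_cast Int.toNat_of_nonneg h0
  refine ⟨fun k => (M + d k).toNat, ?_, ?_⟩
  · have hmid : ∑ k : Fin m, (2 * ((k : ℕ) : ℝ) + 1 - m) = 0 := by
      simp_rw [← sum_indicator_le_sub, sum_sub_distrib]
      rw [sum_comm, sub_self]
    have : ∑ k : Fin m, (d k : ℝ) * (2 * (k : ℕ) + 1 - m) =
        2 * ∑ k, (d k : ℝ) * (k : ℕ) + (1 - m) * ∑ k, (d k : ℝ) := by
      rw [mul_sum, mul_sum, ← sum_add_distrib]
      exact sum_congr rfl fun k _ => by ring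
    simp_rw [hw, add_mul, sum_add_distrib, ← mul_sum]
    rw [hmid, this, hd0]
    linarith
  · have hmid : ∑ k, ∑ j, (s k - s j) = 0 := by
      simp_rw [sum_sub_distrib]
      rw [sum_comm, sub_self]
    have : ∑ k, (d k : ℝ) * ∑ j, (s k - s j) =
        m * ∑ k, (d k : ℝ) * s k - (∑ k, (d k : ℝ)) * ∑ j, s j := by
      rw [mul_sum, sum_mul, ← sum_sub_distrib]
      exact sum_congr rfl fun k _ => by
        rw [sum_sub_distrib, sum_const, card_univ, Fintype.card_fin, nsmul_eq_mul]; ring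
    simp_rw [hw, add_mul, sum_add_distrib, ← mul_sum]
    rw [hmid, this, hd0]
    have : (0 : ℝ) ≤ m * ∑ k, (d k : ℝ) * s k := by positivity
    linarith

/-- There is a profile in which each ranking `σ` is held by exactly `w σ` voters. -/
lemma exists_profile_of_weights {m : ℕ} (w : Equiv.Perm (Fin m) → ℕ) :
    ∃ (n : ℕ) (P : Profile m n), ∀ F : Equiv.Perm (Fin m) → ℝ,
      ∑ i, F (P i) = ∑ σ, (w σ : ℝ) * F σ := by
  let V := Σ σ : Equiv.Perm (Fin m), Fin (w σ)
  refine ⟨Fintype.card V, fun i => ((Fintype.equivFin V).symm i).1, fun F => ?_⟩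
  rw [Equiv.sum_comp (Fintype.equivFin V).symm fun v : V => F v.1, Fintype.sum_sigma]
  simp

/-- Every non-Borda scoring rule selects a Condorcet loser at some profile. -/
theorem non_borda_selects_condorcet_loser
    (m : ℕ) (hm : 3 ≤ m) (s : Fin m → ℝ) (hs : IsScoreVec s)
    (hsB : s ≠ bordaVec m) :
    ∃ n : ℕ, 0 < n ∧ ∃ (P : Profile m n) (x : Fin m),
      x ∈ winners s P ∧ CondorcetLoser P x := by
  obtain ⟨w, hrank, hscore⟩ := exists_rank_weights hm hs hsB
  let x : Fin m := ⟨0, by omega⟩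
  obtain ⟨n, P, hP⟩ := exists_profile_of_weights fun σ : Equiv.Perm (Fin m) => w (σ x)
  have hm3 : (3 : ℝ) ≤ m := by exact_mod_cast hm
  have hm0 : (0 : ℝ) < m := by linarith
  have hm1 : (0 : ℝ) < m - 1 := by linarith
  have hperm : (0 : ℝ) < Fintype.card (Equiv.Perm (Fin m)) := by
    exact_mod_cast Fintype.card_pos
  have hloser : CondorcetLoser P x := by
    intro y hy
    have hpair := card_mul_sum_perm_pair
      (fun k j => (w k : ℝ) * ((if j ≤ k then (1 : ℝ) else 0) - if k ≤ j then 1 else 0))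
      (by simp) hy
    simp_rw [← mul_sum, sum_indicator_le_sub, Fintype.card_fin] at hpair
    have hpos := mul_pos hperm hrank
    rw [← hpair, mul_pos_iff_of_pos_left hm0, mul_pos_iff_of_pos_left hm1,
      ← hP fun σ => (if σ y ≤ σ x then (1 : ℝ) else 0) - if σ x ≤ σ y then 1 else 0,
      sum_sub_distrib, sum_boole, sum_boole, sub_pos] at hpos
    exact_mod_cast hpos
  refine ⟨n, ?_, P, x, fun y => ?_, hloser⟩
  · have hlt := hloser ⟨1, by omega⟩ (by simp [x])
    have hle := (card_pos.1 (Nat.zero_lt_of_lt hlt)).mono (filter_subset _ _)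
    simpa using card_pos.2 hle
  · rcases eq_or_ne y x with rfl | hy
    · exact le_rfl
    have hpair := card_mul_sum_perm_pair (fun k j => (w k : ℝ) * (s k - s j)) (by simp) hy
    simp_rw [← mul_sum, Fintype.card_fin] at hpair
    have hnonneg := mul_nonneg hperm.le hscore
    rw [← hpair, mul_nonneg_iff_of_pos_left hm0, mul_nonneg_iff_of_pos_left hm1,
      ← hP fun σ => s (σ x) - s (σ y), sum_sub_distrib, sub_nonneg] at hnonneg
    exact hnonneg
end

section
/- Let m ≥ 3, let s be a score vector that is not the Borda score vector, and let s' ≠ s be any score vector. Then there exists a preference profile ≿ such that (1) x_1 is a Condorcet loser at ≿, (2) f^s(≿) = {x_1}, and (3) x_1 ∉ f^{s'}(≿). -/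
open Finset

open scoped Matrix

/-- Real weights that make finitely many functionals positive can be replaced by natural
multiplicities, provided that each functional vanishes on the uniform weight. -/
theorem exists_multiset_pos_of_weight {Ω J : Type*} [Fintype Ω] [Finite J] [Nonempty J]
    (φ : J → Ω → ℝ) (hφ : ∀ j, ∑ σ, φ j σ = 0) (w : Ω → ℝ) (hw : ∀ j, 0 < w ⬝ᵥ φ j) :
    ∃ n : ℕ, 0 < n ∧ ∃ P : Fin n → Ω, ∀ j, 0 < ∑ i, φ j (P i) := by
  classical
  cases nonempty_fintype J
  obtain ⟨K, hK⟩ : ∃ K : ℝ, ∀ σ, 0 ≤ w σ + K := by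
    refine ⟨∑ σ, |w σ|, fun σ => ?_⟩
    have h := single_le_sum (f := fun σ => |w σ|) (fun _ _ => abs_nonneg _) (mem_univ σ)
    have h' := neg_abs_le (w σ)
    linarith
  obtain ⟨N, hN⟩ : ∃ N : ℕ, ∀ j, ∑ σ, |φ j σ| < N * (w ⬝ᵥ φ j) := by
    have h : ∀ j, ∃ N : ℕ, ∑ σ, |φ j σ| < N * (w ⬝ᵥ φ j) := fun j => by
      obtain ⟨N, hN⟩ := exists_nat_gt ((∑ σ, |φ j σ|) / (w ⬝ᵥ φ j))
      exact ⟨N, (div_lt_iff₀ (hw j)).1 hN⟩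
    choose N hN using h
    refine ⟨∑ j, N j, fun j => (hN j).trans_le ?_⟩
    have h := single_le_sum (f := N) (fun _ _ => Nat.zero_le _) (mem_univ j)
    have h' : (N j : ℝ) ≤ ((∑ j, N j : ℕ) : ℝ) := by exact_mod_cast h
    exact mul_le_mul_of_nonneg_right h' (hw j).le
  let c : Ω → ℕ := fun σ => ⌊(N : ℝ) * (w σ + K)⌋₊
  have key : ∀ j, 0 < ∑ σ, (c σ : ℝ) * φ j σ := fun j => by
    have hterm : ∀ σ, (N : ℝ) * (w σ * φ j σ) + N * K * φ j σ - |φ j σ| ≤ (c σ : ℝ) * φ j σ := by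
      intro σ
      have h0 : 0 ≤ (N : ℝ) * (w σ + K) := mul_nonneg (Nat.cast_nonneg _) (hK σ)
      have h1 : (c σ : ℝ) ≤ N * (w σ + K) := Nat.floor_le h0
      have h2 : (N : ℝ) * (w σ + K) < c σ + 1 := Nat.lt_floor_add_one _
      have h3 : ((N : ℝ) * (w σ + K) - c σ) * φ j σ ≤ 1 * |φ j σ| :=
        (mul_le_mul_of_nonneg_left (le_abs_self _) (by linarith)).trans
          (mul_le_mul_of_nonneg_right (by linarith) (abs_nonneg _))
      linarith
    have h := sum_le_sum fun σ (_ : σ ∈ univ) => hterm σ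
    rw [sum_sub_distrib, sum_add_distrib, ← mul_sum, ← mul_sum, hφ j] at h
    have := hN j
    rw [dotProduct] at this
    linarith
  let e := (Fintype.equivFin (Σ σ, Fin (c σ))).symm
  have hsum : ∀ j, ∑ i, φ j (e i).1 = ∑ σ, (c σ : ℝ) * φ j σ := fun j => by
    rw [e.sum_comp (fun i => φ j i.1), Fintype.sum_sigma]
    simp
  refine ⟨_, ?_, fun i => (e i).1, fun j => (hsum j).symm ▸ key j⟩
  rw [Nat.pos_iff_ne_zero]
  intro h0
  obtain ⟨j⟩ := ‹Nonempty J›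
  have h := key j
  rw [← hsum j] at h
  have : IsEmpty (Fin (Fintype.card (Σ σ, Fin (c σ)))) := by rw [h0]; infer_instance
  simp at h

/-- An antisymmetric function of the positions of two alternatives sums to zero over all orders. -/
theorem sum_perm_antisymm {α β : Type*} [Fintype α] [Fintype β] [DecidableEq α] [DecidableEq β]
    (h : β → β → ℝ) (hh : ∀ p q, h p q = -h q p) (a b : α) :
    ∑ σ : α ≃ β, h (σ a) (σ b) = 0 := by
  have h1 : ∑ σ : α ≃ β, h (σ a) (σ b) = ∑ σ : α ≃ β, h (σ b) (σ a) := by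
    refine Fintype.sum_equiv ((Equiv.swap a b).equivCongr (Equiv.refl β)) _ _ fun σ => ?_
    simp [Equiv.equivCongr]
  have h2 : ∑ σ : α ≃ β, h (σ a) (σ b) = -∑ σ : α ≃ β, h (σ b) (σ a) := by
    rw [← sum_neg_distrib]
    exact sum_congr rfl fun σ _ => hh _ _
  linarith

theorem exists_perm_apply_eq {α : Type*} [DecidableEq α] {a b p q : α} (hab : a ≠ b)
    (hpq : p ≠ q) : ∃ σ : α ≃ α, σ a = p ∧ σ b = q := by
  refine ⟨(Equiv.swap a p).trans (Equiv.swap (Equiv.swap a p b) q), ?_, by simp⟩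
  have h : p ≠ Equiv.swap a p b := fun h =>
    hab ((Equiv.swap a p).injective ((Equiv.swap_apply_left a p).trans h))
  simp [Equiv.swap_apply_of_ne_of_ne h hpq]

/-- The difference in score between two consecutive ranks `k` and `k + 1`. -/
def gap {m : ℕ} (s : Fin m → ℝ) (k : Fin (m - 1)) : ℝ :=
  s ⟨k, by omega⟩ - s ⟨k + 1, by omega⟩

/-- The indicator comparison of two ranks: `1` if `p` is better than `q`, `-1` if it is worse. -/
def rankSign {m : ℕ} (p q : Fin m) : ℝ :=
  (if p ≤ q then 1 else 0) - (if q ≤ p then 1 else 0)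

theorem rankSign_antisymm {m : ℕ} (p q : Fin m) : rankSign p q = -rankSign q p := by
  simp [rankSign]

/-- Weights exchanging `a` and `b` at the adjacent ranks `k` and `k + 1`: only the margin between
`a` and `b` changes, and their scores move in opposite directions by the gap at `k`. -/
theorem exists_swap_weight {m : ℕ} (a b : Fin m) (hab : a ≠ b) (k : Fin (m - 1)) :
    ∃ w : (Fin m ≃ Fin m) → ℝ,
      (∀ (f : Fin m → ℝ) (z : Fin m), (w ⬝ᵥ fun σ => f (σ z)) =
        (if z = a then 1 else if z = b then -1 else 0) * gap f k) ∧
      ∀ y z : Fin m, (w ⬝ᵥ fun σ => rankSign (σ y) (σ z)) =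
        if y = a ∧ z = b then 2 else if y = b ∧ z = a then -2 else 0 := by
  classical
  obtain ⟨L, hLa, hLb⟩ := exists_perm_apply_eq (p := (⟨k, by omega⟩ : Fin m))
    (q := ⟨k + 1, by omega⟩) hab (by simp)
  refine ⟨Pi.single L 1 - Pi.single ((Equiv.swap a b).trans L) 1, fun f z => ?_, fun y z => ?_⟩
  · simp only [sub_dotProduct, single_dotProduct, Equiv.trans_apply, one_mul]
    by_cases hza : z = a
    · subst hza
      simp [hLa, hLb, gap]
    by_cases hzb : z = b
    · subst hzb
      simp [hLa, hLb, gap, hza]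
    simp [hza, hzb, Equiv.swap_apply_of_ne_of_ne hza hzb]
  · simp only [sub_dotProduct, single_dotProduct, Equiv.trans_apply, one_mul]
    have hne : ∀ u, u ≠ a → u ≠ b → (L u : ℕ) ≠ k ∧ (L u : ℕ) ≠ k + 1 := fun u hua hub =>
      ⟨fun h => hua (L.injective (by rw [hLa]; exact Fin.ext h)),
        fun h => hub (L.injective (by rw [hLb]; exact Fin.ext h))⟩
    have hcase : ∀ u, u = a ∨ u = b ∨
        (u ≠ a ∧ u ≠ b ∧ Equiv.swap a b u = u ∧ (L u : ℕ) ≠ k ∧ (L u : ℕ) ≠ k + 1) := fun u => by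
      by_cases hua : u = a
      · exact Or.inl hua
      by_cases hub : u = b
      · exact Or.inr (Or.inl hub)
      exact Or.inr (Or.inr ⟨hua, hub, Equiv.swap_apply_of_ne_of_ne hua hub, hne u hua hub⟩)
    rcases hcase y with rfl | rfl | ⟨hya, hyb, hy, hy1, hy2⟩ <;>
    rcases hcase z with rfl | rfl | ⟨hza, hzb, hz, hz1, hz2⟩ <;>
    simp only [Equiv.swap_apply_left, Equiv.swap_apply_right, rankSign, Fin.le_def, *] <;>
    grind

theorem gap_nonneg {m : ℕ} {s : Fin m → ℝ} (hs : IsScoreVec s) (k : Fin (m - 1)) :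
    0 ≤ gap s k :=
  sub_nonneg.2 (hs.1 (by simp [Fin.le_def]))

theorem sum_gap {m : ℕ} (hm : 1 ≤ m) (s : Fin m → ℝ) (j : ℕ) (hj : j < m) :
    ∑ k : Fin (m - 1), (if (k : ℕ) < j then gap s k else 0) = s ⟨0, by omega⟩ - s ⟨j, hj⟩ := by
  induction j with
  | zero => simp
  | succ j ih =>
    have h : ∀ k : Fin (m - 1), (if (k : ℕ) < j + 1 then gap s k else 0) =
        (if (k : ℕ) < j then gap s k else 0) +
          if k = ⟨j, by omega⟩ then gap s k else 0 := fun k => by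
      simp only [Fin.ext_iff]
      split_ifs <;> first | omega | simp
    rw [sum_congr rfl fun k _ => h k, sum_add_distrib, ih (by omega), sum_ite_eq',
      if_pos (mem_univ _), gap]
    ring

theorem IsScoreVec.sum_gap_eq_one {m : ℕ} (hm : 1 ≤ m) {s : Fin m → ℝ} (hs : IsScoreVec s) :
    ∑ k, gap s k = 1 := by
  have h := sum_gap hm s (m - 1) (by omega)
  rw [hs.2.2.1 _ rfl, hs.2.2.2 _ rfl] at h
  simpa using h

/-- Distinct score vectors have non-proportional gaps. -/
theorem exists_gap_mul_ne {m : ℕ} (hm : 1 ≤ m) {s t : Fin m → ℝ} (hs : IsScoreVec s)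
    (ht : IsScoreVec t) (hne : s ≠ t) : ∃ k l, gap s k * gap t l ≠ gap s l * gap t k := by
  by_contra! h
  have hgap : ∀ k, gap s k = gap t k := fun k => by
    have h1 := sum_congr rfl fun l (_ : l ∈ univ) => h k l
    rwa [← mul_sum, ← sum_mul, hs.sum_gap_eq_one hm, ht.sum_gap_eq_one hm, mul_one, one_mul] at h1
  refine hne (funext fun j => ?_)
  have h1 := sum_gap hm s j j.2
  have h2 := sum_gap hm t j j.2
  simp only [hgap] at h1
  rw [h1, hs.2.2.1 _ rfl, ht.2.2.1 _ rfl] at h2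
  simpa using h2

theorem gap_bordaVec {m : ℕ} (k : Fin (m - 1)) : gap (bordaVec m) k = 1 / ((m : ℝ) - 1) := by
  simp only [gap, bordaVec, ← sub_div]
  push_cast
  ring

theorem isScoreVec_bordaVec {m : ℕ} (hm : 2 ≤ m) : IsScoreVec (bordaVec m) := by
  have h2 : (2 : ℝ) ≤ m := by exact_mod_cast hm
  have hpos : (0 : ℝ) < (m : ℝ) - 1 := by linarith
  have hle : ∀ k : Fin m, ((k : ℕ) : ℝ) + 1 ≤ m := fun k => by exact_mod_cast k.2
  refine ⟨fun k l hkl => ?_, fun k => ⟨?_, ?_⟩, fun k hk => ?_, fun k hk => ?_⟩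
  · have : ((k : ℕ) : ℝ) ≤ (l : ℕ) := by exact_mod_cast hkl
    exact div_le_div_of_nonneg_right (by linarith) hpos.le
  · exact div_nonneg (by linarith [hle k]) hpos.le
  · exact (div_le_one hpos).2 (by linarith [Nat.cast_nonneg (α := ℝ) (k : ℕ)])
  · simp [bordaVec, hk, hpos.ne']
  · simp [bordaVec, hk, Nat.cast_sub (show 1 ≤ m by omega)]

theorem exists_gap_lt {m : ℕ} (hm : 2 ≤ m) {s : Fin m → ℝ} (hs : IsScoreVec s)
    (hsB : s ≠ bordaVec m) : ∃ k l, gap s l < gap s k := by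
  obtain ⟨k, l, h⟩ := exists_gap_mul_ne (by omega) hs (isScoreVec_bordaVec hm) hsB
  rw [gap_bordaVec, gap_bordaVec] at h
  have hkl : gap s k ≠ gap s l := fun e => h (by rw [e])
  rcases hkl.lt_or_gt with hlt | hlt
  exacts [⟨l, k, hlt⟩, ⟨k, l, hlt⟩]

/-- Weights at which `x` is a Condorcet loser and has the strictly largest `s`-score. -/
theorem exists_weight_condorcetLoser {m : ℕ} (hm : 2 ≤ m) {s : Fin m → ℝ} (hs : IsScoreVec s)
    (hsB : s ≠ bordaVec m) (x : Fin m) : ∃ w : (Fin m ≃ Fin m) → ℝ, ∀ y, y ≠ x →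
      0 < (w ⬝ᵥ fun σ => rankSign (σ y) (σ x)) ∧
      (w ⬝ᵥ fun σ => s (σ y)) < w ⬝ᵥ fun σ => s (σ x) := by
  classical
  obtain ⟨k, l, hkl⟩ := exists_gap_lt hm hs hsB
  have hl := gap_nonneg hs l
  have hpair : ∀ y : {y // y ≠ x}, ∃ w : (Fin m ≃ Fin m) → ℝ,
      (∀ z, (w ⬝ᵥ fun σ => s (σ z)) =
        (if z = x then 1 else if z = y then -1 else 0) * (gap s k * (gap s k - gap s l))) ∧
      ∀ z, z ≠ x → (w ⬝ᵥ fun σ => rankSign (σ z) (σ x)) =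
        if z = y then 2 * (gap s k - gap s l) else 0 := fun y => by
    obtain ⟨u, hu, hu'⟩ := exists_swap_weight x y y.2.symm k
    obtain ⟨v, hv, hv'⟩ := exists_swap_weight x y y.2.symm l
    refine ⟨(gap s k + gap s l) • u - (2 * gap s k) • v, fun z => ?_, fun z hz => ?_⟩
    · simp only [sub_dotProduct, smul_dotProduct, hu, hv, smul_eq_mul]
      ring
    · simp only [sub_dotProduct, smul_dotProduct, hu', hv', smul_eq_mul, hz, false_and, if_false,
        and_true]
      split_ifs <;> ring
  choose w hw hw' using hpair
  have hpos : 0 < gap s k * (gap s k - gap s l) := mul_pos (by linarith) (by linarith)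
  refine ⟨∑ y, w y, fun y hy => ⟨?_, ?_⟩⟩
  · rw [sum_dotProduct]
    refine sum_pos' (fun z _ => ?_) ⟨⟨y, hy⟩, mem_univ _, ?_⟩
    · rw [hw' z y hy]
      split_ifs <;> linarith
    · rw [hw' _ y hy, if_pos rfl]
      linarith
  · rw [sum_dotProduct, sum_dotProduct]
    refine sum_lt_sum_of_nonempty ⟨⟨y, hy⟩, mem_univ _⟩ fun z _ => ?_
    rw [hw, hw, if_neg hy, if_pos rfl]
    split_ifs <;> linarith

/-- Weights that raise the `t`-score of `y` but affect neither any `s`-score nor the margins and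
the `t`-score of a third alternative `x`. -/
theorem exists_weight_neutral {m : ℕ} (hm : 1 ≤ m) {s t : Fin m → ℝ} (hs : IsScoreVec s)
    (ht : IsScoreVec t) (hne : s ≠ t) {x y z : Fin m} (hxy : x ≠ y) (hxz : x ≠ z) (hyz : y ≠ z) :
    ∃ w : (Fin m ≃ Fin m) → ℝ, (∀ a, (w ⬝ᵥ fun σ => rankSign (σ a) (σ x)) = 0) ∧
      (∀ a, (w ⬝ᵥ fun σ => s (σ a)) = 0) ∧ (w ⬝ᵥ fun σ => t (σ x)) = 0 ∧
      (w ⬝ᵥ fun σ => t (σ y)) = 1 := by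
  obtain ⟨k, l, hkl⟩ := exists_gap_mul_ne hm hs ht hne
  obtain ⟨u, hu, hu'⟩ := exists_swap_weight y z hyz k
  obtain ⟨v, hv, hv'⟩ := exists_swap_weight y z hyz l
  refine ⟨(gap s k * gap t l - gap s l * gap t k)⁻¹ • (gap s k • v - gap s l • u),
    fun a => ?_, fun a => ?_, ?_, ?_⟩
  · simp [sub_dotProduct, smul_dotProduct, hu', hv', hxy, hxz]
  · simp only [sub_dotProduct, smul_dotProduct, hu, hv, smul_eq_mul]
    ring
  · simp [sub_dotProduct, smul_dotProduct, hu, hv, hxy, hxz]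
  · simp only [sub_dotProduct, smul_dotProduct, hu, hv, smul_eq_mul, if_true, one_mul]
    exact inv_mul_cancel₀ (sub_ne_zero.2 hkl)

/-- For any non-Borda score vector `s` and any score vector `s' ≠ s`, there is a
profile at which `x_1` is a Condorcet loser, `f^s` selects exactly `{x_1}`, and
`f^{s'}` does not select `x_1`. -/
theorem exists_profile_separating
    (m : ℕ) (hm : 3 ≤ m) (s s' : Fin m → ℝ)
    (hs : IsScoreVec s) (hs' : IsScoreVec s')
    (hsB : s ≠ bordaVec m) (hne : s' ≠ s) :
    ∃ n : ℕ, 0 < n ∧ ∃ P : Profile m n,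
      CondorcetLoser P ⟨0, by omega⟩ ∧
      winners s P = {(⟨0, by omega⟩ : Fin m)} ∧
      (⟨0, by omega⟩ : Fin m) ∉ winners s' P := by
  classical
  let x : Fin m := ⟨0, by omega⟩
  let y₀ : Fin m := ⟨1, by omega⟩
  let z₀ : Fin m := ⟨2, by omega⟩
  have hy₀ : y₀ ≠ x := by simp [x, y₀]
  obtain ⟨w₁, hw₁⟩ := exists_weight_condorcetLoser (by omega) hs hsB x
  obtain ⟨w₂, hmar, hsc, hx, hy⟩ := exists_weight_neutral (x := x) (y := y₀) (z := z₀) (by omega)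
    hs hs' hne.symm hy₀.symm (by simp [x, z₀]) (by simp [y₀, z₀])
  let c : ℝ := 1 + (w₁ ⬝ᵥ fun σ => s' (σ x)) - w₁ ⬝ᵥ fun σ => s' (σ y₀)
  let φ : {y // y ≠ x} ⊕ {y // y ≠ x} ⊕ Unit → (Fin m ≃ Fin m) → ℝ :=
    Sum.elim (fun y σ => rankSign (σ y) (σ x)) (Sum.elim (fun y σ => s (σ x) - s (σ y))
      fun _ σ => s' (σ y₀) - s' (σ x))
  have hsub : ∀ (w : (Fin m ≃ Fin m) → ℝ) (f : Fin m → ℝ) (a b : Fin m),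
      (w ⬝ᵥ fun σ => f (σ a) - f (σ b)) = (w ⬝ᵥ fun σ => f (σ a)) - w ⬝ᵥ fun σ => f (σ b) :=
    fun w f a b => dotProduct_sub w (fun σ => f (σ a)) fun σ => f (σ b)
  obtain ⟨n, hn, P, hP⟩ := exists_multiset_pos_of_weight φ
    (by
      rintro (y | y | _)
      · exact sum_perm_antisymm rankSign rankSign_antisymm _ _
      · exact sum_perm_antisymm (fun p q => s p - s q) (fun p q => by ring) _ _
      · exact sum_perm_antisymm (fun p q => s' p - s' q) (fun p q => by ring) _ _)
    (w₁ + c • w₂)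
    (by
      rintro (y | y | _)
      · simpa [φ, add_dotProduct, smul_dotProduct, hmar] using (hw₁ y y.2).1
      · simpa [φ, add_dotProduct, smul_dotProduct, hsub, hsc] using (hw₁ y y.2).2
      · simp only [φ, Sum.elim_inr, add_dotProduct, smul_dotProduct, hsub, hx, hy, smul_eq_mul, c]
        linarith)
  have hwin : ∀ y, y ≠ x → score s P y < score s P x := fun y hy => by
    simpa [φ, score] using hP (Sum.inr (Sum.inl ⟨y, hy⟩))
  refine ⟨n, hn, P, fun y hy => ?_, ?_, fun h => ?_⟩
  · have h := hP (Sum.inl ⟨y, hy⟩)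
    simp only [φ, Sum.elim_inl, rankSign, sum_sub_distrib, sum_boole, sub_pos] at h
    exact_mod_cast h
  · ext y
    simp only [winners, Set.mem_ofPred_eq, Set.mem_singleton_iff]
    refine ⟨fun h => ?_, ?_⟩
    · by_contra hy
      exact (hwin y hy).not_ge (h x)
    · rintro rfl z
      by_cases hz : z = x
      · rw [hz]
      · exact (hwin z hz).le
  · have h' := hP (Sum.inr (Sum.inr ()))
    simp only [φ, Sum.elim_inr, sum_sub_distrib, sub_pos] at h'
    exact h'.not_ge (h y₀)
end

section
/- Let m ≥ 3. The Borda rule CL-dominates every other scoring rule: for every score vector s ≠ s^B, L(f^{s^B}) is a proper subset of L(f^s). -/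
open Finset

/-- `L(f^s)`: the set of (nonempty-electorate) preference profiles at which the
scoring rule `f^s` selects at least one Condorcet loser. -/
def Lset {m : ℕ} (s : Fin m → ℝ) : Set ((n : ℕ) × Profile m n) :=
  {P | 0 < P.1 ∧ ∃ x ∈ winners s P.2, CondorcetLoser P.2 x}

/-- The sum of `h (π x) (π y)` over all permutations is the same for all pairs `x ≠ y`. -/
lemma sum_perm_pair_eq {α : Type*} [Fintype α] [DecidableEq α] (h : α → α → ℝ)
    {x y x' y' : α} (hxy : x ≠ y) (hxy' : x' ≠ y') :
    ∑ π : Equiv.Perm α, h (π x) (π y) = ∑ π : Equiv.Perm α, h (π x') (π y') := by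
  obtain ⟨τ, hx, hy⟩ : ∃ τ : Equiv.Perm α, τ x' = x ∧ τ y' = y := by
    refine ⟨(Equiv.swap x' x).trans (Equiv.swap (Equiv.swap x' x y') y), ?_, ?_⟩
    · have hne : x ≠ Equiv.swap x' x y' := by
        intro h
        apply hxy'
        apply (Equiv.swap x' x).injective
        rw [Equiv.swap_apply_left, ← h]
      simp [Equiv.swap_apply_of_ne_of_ne hne hxy]
    · simp
  rw [← Equiv.sum_comp (Equiv.mulRight τ) (fun π : Equiv.Perm α => h (π x') (π y'))]
  simp [hx, hy]

/-- The double sum of `h` over all pairs is, up to a positive factor, the sum of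
`h (π x) (π y)` over all permutations, provided `h` vanishes on the diagonal. -/
lemma exists_pos_mul_sum_perm_pair {α : Type*} [Fintype α] [DecidableEq α] (h : α → α → ℝ)
    (hdiag : ∀ a, h a a = 0) {x y : α} (hxy : x ≠ y) :
    ∃ c : ℝ, 0 < c ∧
      ∑ π : Equiv.Perm α, h (π x) (π y) = c * ∑ a, ∑ b, h a b := by
  set S := ∑ π : Equiv.Perm α, h (π x) (π y) with hS
  set p : ℝ := ∑ a : α, ∑ b : α, if a = b then 0 else 1 with hp
  set q : ℝ := (Fintype.card (Equiv.Perm α) : ℝ) with hq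
  have hq0 : 0 < q := by
    rw [hq]
    exact_mod_cast Fintype.card_pos
  have hp0 : 0 < p := by
    have hnn : ∀ a b : α, (0 : ℝ) ≤ if a = b then 0 else 1 := by
      intro a b
      split_ifs <;> norm_num
    refine sum_pos' (fun a _ => sum_nonneg fun b _ => hnn a b) ⟨x, mem_univ x, ?_⟩
    exact sum_pos' (fun b _ => hnn x b) ⟨y, mem_univ y, by simp [hxy]⟩
  have hsum : p * S = q * ∑ a, ∑ b, h a b := by
    have hpS : p * S = ∑ a : α, ∑ b : α, ∑ π : Equiv.Perm α, h (π a) (π b) := by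
      rw [hp, sum_mul]
      refine sum_congr rfl fun a _ => ?_
      rw [sum_mul]
      refine sum_congr rfl fun b _ => ?_
      by_cases hab : a = b
      · simp [hab, hdiag]
      · simp only [hab, if_false, one_mul]
        exact sum_perm_pair_eq h hxy hab
    have hperm (π : Equiv.Perm α) : ∑ a, ∑ b, h (π a) (π b) = ∑ a, ∑ b, h a b := by
      rw [← Equiv.sum_comp π (fun a => ∑ b, h a b)]
      exact sum_congr rfl fun a _ => Equiv.sum_comp π (h (π a))
    rw [hpS, sum_congr rfl fun a _ => sum_comm, sum_comm, sum_congr rfl fun π _ => hperm π]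
    simp [hq]
  refine ⟨q / p, by positivity, ?_⟩
  field_simp
  linarith

/-- The contribution of a voter ranking `x` at `k` and `y` at `j` to the majority margin
of `y` over `x`. -/
noncomputable def rankMargin {m : ℕ} (k j : Fin m) : ℝ :=
  (if j ≤ k then 1 else 0) - (if k ≤ j then 1 else 0)

lemma sum_rankMargin {m : ℕ} (k : Fin m) : ∑ j, rankMargin k j = 2 * (k : ℕ) + 1 - m := by
  have hle : univ.filter (fun j => j ≤ k) = Iic k := by ext; simp
  have hge : univ.filter (fun j => k ≤ j) = Ici k := by ext; simp
  simp only [rankMargin, sum_sub_distrib, sum_boole, hle, hge, Fin.card_Iic, Fin.card_Ici]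
  rw [Nat.cast_sub k.isLt.le]
  push_cast
  ring

lemma condorcetLoser_iff {m n : ℕ} (P : Profile m n) (x : Fin m) :
    CondorcetLoser P x ↔ ∀ y, y ≠ x → 0 < ∑ i, rankMargin (P i x) (P i y) := by
  simp only [CondorcetLoser, rankMargin, sum_sub_distrib, sum_boole, sub_pos, Nat.cast_lt]

lemma two_mul_sum_fin_cast (m : ℕ) : 2 * ∑ k : Fin m, ((k : ℕ) : ℝ) = m * (m - 1) := by
  induction m with
  | zero => simp
  | succ n ih =>
    rw [Fin.sum_univ_castSucc, mul_add]
    simp only [Fin.val_castSucc, Fin.val_last]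
    rw [ih]
    push_cast
    ring

lemma two_mul_sum_bordaVec {m : ℕ} (hm : 3 ≤ m) : 2 * ∑ k, bordaVec m k = m := by
  have hm' : (3 : ℝ) ≤ m := by exact_mod_cast hm
  have hne : (m : ℝ) - 1 ≠ 0 := by linarith
  have h := two_mul_sum_fin_cast m
  simp only [bordaVec]
  rw [← sum_div, sum_sub_distrib]
  simp only [sum_const, card_univ, Fintype.card_fin, nsmul_eq_mul]
  field_simp
  linarith

/-- The Borda rule never selects a Condorcet loser. -/
lemma Lset_bordaVec_eq_empty {m : ℕ} (hm : 3 ≤ m) : Lset (bordaVec m) = ∅ := by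
  refine Set.eq_empty_of_forall_notMem ?_
  rintro ⟨n, P⟩ ⟨-, x, hwin, hloser⟩
  rw [condorcetLoser_iff] at hloser
  have hm' : (3 : ℝ) ≤ m := by exact_mod_cast hm
  have hpos : 0 < ∑ y, ∑ i, rankMargin (P i x) (P i y) := by
    obtain ⟨y, hy⟩ : ∃ y : Fin m, y ≠ x := by
      have : Nontrivial (Fin m) := Fin.nontrivial_iff_two_le.2 (by omega)
      exact exists_ne x
    refine sum_pos' (fun z _ => ?_) ⟨y, mem_univ y, hloser y hy⟩
    by_cases hz : z = x
    · simp [hz, rankMargin]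
    · exact (hloser z hz).le
  rw [sum_comm, sum_congr rfl fun i _ =>
    (Equiv.sum_comp (P i) (rankMargin (P i x))).trans (sum_rankMargin _)] at hpos
  have hscore : ∑ y, score (bordaVec m) P y ≤ m * score (bordaVec m) P x := by
    simpa using sum_le_sum fun y (_ : y ∈ univ) => hwin y
  have htotal : 2 * ∑ y, score (bordaVec m) P y = n * m := by
    simp only [score]
    rw [sum_comm, sum_congr rfl fun i _ => Equiv.sum_comp (P i) (bordaVec m), mul_sum,
      sum_congr rfl fun i _ => two_mul_sum_bordaVec hm]
    simp
  have hx : (m - 1) * (2 * score (bordaVec m) P x - n) =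
      -∑ i, (2 * ((P i x : ℕ) : ℝ) + 1 - m) := by
    have hne : (m : ℝ) - 1 ≠ 0 := by linarith
    have hn : (n : ℝ) = ∑ _i : Fin n, (1 : ℝ) := by simp
    rw [hn, score, mul_sum, ← sum_sub_distrib, mul_sum, ← sum_neg_distrib]
    refine sum_congr rfl fun i _ => ?_
    simp only [bordaVec]
    field_simp
    ring
  have hge : 0 ≤ 2 * score (bordaVec m) P x - n := by
    by_contra! hlt
    nlinarith
  nlinarith [mul_nonneg (by linarith : (0 : ℝ) ≤ m - 1) hge]

/-- A profile, up to relabelling of voters, in which each ranking `π` occurs `w (π x)` times. -/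
lemma exists_profile_sum_eq {m : ℕ} (w : Fin m → ℕ) (x : Fin m) :
    ∃ (n : ℕ) (P : Profile m n), ∀ F : Equiv.Perm (Fin m) → ℝ,
      ∑ i, F (P i) = ∑ π : Equiv.Perm (Fin m), w (π x) * F π := by
  let V := Σ π : Equiv.Perm (Fin m), Fin (w (π x))
  refine ⟨Fintype.card V, fun i => ((Fintype.equivFin V).symm i).1, fun F => ?_⟩
  rw [Equiv.sum_comp (Fintype.equivFin V).symm (fun v : V => F v.1), Fintype.sum_sigma]
  simp

/-- If some weighting of the ranks of `x` gives `x` a below-average position but an at least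
average score, then the scoring rule selects a Condorcet loser at some profile. -/
lemma Lset_nonempty_of_weights {m : ℕ} (hm : 3 ≤ m) (s : Fin m → ℝ) (w : Fin m → ℕ)
    (hrank : 0 < ∑ k, (w k : ℝ) * (2 * (k : ℕ) + 1 - m))
    (hscore : 0 ≤ ∑ k, (w k : ℝ) * (m * s k - ∑ j, s j)) : (Lset s).Nonempty := by
  let x : Fin m := ⟨0, by omega⟩
  obtain ⟨n, P, hP⟩ := exists_profile_sum_eq w x
  have hloser : CondorcetLoser P x := by
    rw [condorcetLoser_iff]
    intro y hy
    rw [hP fun π => rankMargin (π x) (π y)]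
    obtain ⟨c, hc, heq⟩ := exists_pos_mul_sum_perm_pair
      (fun k j => (w k : ℝ) * rankMargin k j) (by simp [rankMargin]) hy.symm
    simp only [← mul_sum, sum_rankMargin] at heq
    rw [heq]
    positivity
  have hwin : x ∈ winners s P := by
    intro y
    by_cases hy : y = x
    · rw [hy]
    rw [← sub_nonneg, score, score, ← sum_sub_distrib, hP fun π => s (π x) - s (π y)]
    obtain ⟨c, hc, heq⟩ := exists_pos_mul_sum_perm_pair
      (fun k j => (w k : ℝ) * (s k - s j)) (by simp) (Ne.symm hy)
    simp only [← mul_sum, sum_sub_distrib, sum_const, card_univ, Fintype.card_fin,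
      nsmul_eq_mul] at heq
    rw [heq]
    positivity
  refine ⟨⟨n, P⟩, ?_, x, hwin, hloser⟩
  have := hloser ⟨1, by omega⟩ (by simp [x])
  refine Nat.pos_of_ne_zero fun h0 => ?_
  change n = 0 at h0
  subst h0
  simp at this

/-- If `e * s j` lies beyond `e * A / B`, which lies beyond `e` times the Borda score of rank `j`,
then the scoring rule selects a Condorcet loser at some profile. -/
lemma Lset_nonempty_of_separation {m : ℕ} (hm : 3 ≤ m) (s : Fin m → ℝ) (hs : IsScoreVec s)
    (j : Fin m) (A B e : ℤ) (hA : 0 ≤ A) (hAB : A ≤ B) (he : e = 1 ∨ e = -1)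
    (hscore : 0 ≤ (e : ℝ) * (B * s j - A))
    (hrank : 0 < (e : ℝ) * (B * (j : ℕ) - (B - A) * (m - 1))) : (Lset s).Nonempty := by
  let a : Fin m := ⟨0, by omega⟩
  let z : Fin m := ⟨m - 1, by omega⟩
  have haz : a ≠ z := by
    simp only [a, z, ne_eq, Fin.mk.injEq]
    omega
  let W : Fin m → ℤ := fun k =>
    B + (if k = j then e * B else 0) - (if k = a then e * A else 0)
      - (if k = z then e * (B - A) else 0)
  have hW : ∀ k, 0 ≤ W k := by
    intro k
    simp only [W]
    by_cases hka : k = a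
    · rcases he with rfl | rfl <;> simp only [hka, haz, if_true, if_false] <;> split_ifs <;> omega
    · rcases he with rfl | rfl <;> simp only [hka, if_false] <;> split_ifs <;> omega
  have hsum (f : Fin m → ℝ) : ∑ k, ((W k).toNat : ℝ) * f k =
      B * ∑ k, f k + e * (B * f j - A * f a - (B - A) * f z) := by
    have hcast (k : Fin m) : ((W k).toNat : ℝ) = W k := by
      exact_mod_cast congrArg (Int.cast : ℤ → ℝ) (Int.toNat_of_nonneg (hW k))
    simp only [hcast, W]
    push_cast
    simp only [sub_mul, add_mul, ite_mul, zero_mul, sum_sub_distrib, sum_add_distrib,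
      sum_ite_eq', mem_univ, if_true, ← mul_sum]
    ring
  have hsa : s a = 1 := hs.2.2.1 a rfl
  have hsz : s z = 0 := hs.2.2.2 z rfl
  have hz : ((z : ℕ) : ℝ) = m - 1 := by
    simp only [z]
    rw [Nat.cast_sub (by omega)]
    simp
  have ha : ((a : ℕ) : ℝ) = 0 := by simp [a]
  refine Lset_nonempty_of_weights hm s (fun k => (W k).toNat) ?_ ?_
  · rw [hsum]
    have h0 : ∑ k : Fin m, (2 * ((k : ℕ) : ℝ) + 1 - m) = 0 := by
      simp only [sum_sub_distrib, sum_add_distrib, ← mul_sum, two_mul_sum_fin_cast]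
      simp
      ring
    rw [h0, ha, hz]
    linarith
  · rw [hsum]
    have h0 : ∑ k : Fin m, (m * s k - ∑ j, s j) = 0 := by
      simp [sum_sub_distrib, ← mul_sum]
    rw [h0, hsa, hsz]
    have := mul_nonneg (Nat.cast_nonneg m : (0 : ℝ) ≤ m) hscore
    linarith

/-- The Borda rule CL-dominates every other scoring rule. -/
theorem borda_cl_dominates
    (m : ℕ) (hm : 3 ≤ m) (s : Fin m → ℝ) (hs : IsScoreVec s)
    (hne : s ≠ bordaVec m) :
    Lset (bordaVec m) ⊂ Lset s := by
  rw [Lset_bordaVec_eq_empty hm, Set.empty_ssubset]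
  obtain ⟨j, hj⟩ := Function.ne_iff.1 hne
  have hm' : (3 : ℝ) ≤ m := by exact_mod_cast hm
  have hpos : (0 : ℝ) < m - 1 := by linarith
  have hj' : ((j : ℕ) : ℝ) ≤ m - 1 := by
    have : ((j : ℕ) : ℝ) + 1 ≤ m := by exact_mod_cast j.isLt
    linarith
  have hb : bordaVec m j * (m - 1) = m - 1 - (j : ℕ) := by
    simp only [bordaVec]
    field_simp
  have hb0 : 0 ≤ bordaVec m j := by
    simp only [bordaVec]
    exact div_nonneg (by linarith) hpos.le
  have hb1 : bordaVec m j ≤ 1 := by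
    simp only [bordaVec]
    rw [div_le_one hpos]
    have : (0 : ℝ) ≤ (j : ℕ) := Nat.cast_nonneg _
    linarith
  obtain ⟨hs0, hs1⟩ := hs.2.1 j
  have hfrac (q : ℚ) : (q : ℝ) * (q.den : ℤ) = q.num := by
    exact_mod_cast Rat.mul_den_eq_num q
  have hden (q : ℚ) : (0 : ℝ) < (q.den : ℤ) := by exact_mod_cast q.den_pos
  have hnum0 {q : ℚ} (hq : (0 : ℝ) ≤ q) : 0 ≤ q.num := Rat.num_nonneg.2 (by exact_mod_cast hq)
  have hnum1 {q : ℚ} (hq : (q : ℝ) ≤ 1) : q.num ≤ (q.den : ℤ) := by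
    have : (q.num : ℝ) ≤ (q.den : ℤ) := by nlinarith [hfrac q, hden q]
    exact_mod_cast this
  rcases lt_or_gt_of_ne hj with hlt | hlt
  · obtain ⟨q, hq1, hq2⟩ := exists_rat_btwn hlt
    refine Lset_nonempty_of_separation hm s hs j q.num q.den (-1)
      (hnum0 (hs0.trans hq1.le)) (hnum1 (hq2.le.trans hb1)) (Or.inr rfl) ?_ ?_
    · rw [← hfrac q]
      push_cast
      nlinarith [mul_pos (hden q) (sub_pos.2 hq1)]
    · rw [← hfrac q]
      have := mul_pos (hden q) (mul_pos (sub_pos.2 hq2) hpos)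
      rw [sub_mul, hb] at this
      push_cast at this ⊢
      linarith
  · obtain ⟨q, hq1, hq2⟩ := exists_rat_btwn hlt
    refine Lset_nonempty_of_separation hm s hs j q.num q.den 1
      (hnum0 (hb0.trans hq1.le)) (hnum1 (hq2.le.trans hs1)) (Or.inl rfl) ?_ ?_
    · rw [← hfrac q]
      push_cast
      nlinarith [mul_pos (hden q) (sub_pos.2 hq2)]
    · rw [← hfrac q]
      have := mul_pos (hden q) (mul_pos (sub_pos.2 hq1) hpos)
      rw [sub_mul, hb] at this
      push_cast at this ⊢
      linarith
end

section
/- Let s and s' be score vectors for three alternatives with 1/2 ≤ s'(2) < s(2) ≤ 1. Then there exists a preference profile ≿ on {x, y, z} such that x is a Condorcet loser at ≿, f^s(≿) = {x}, and x ∉ f^{s'}(≿). -/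
open Finset

/-- The profile in which, writing `x, y, z` for `0, 1, 2`, there are `b` voters with each of the
orders `yxz` and `zxy`, and `c` voters with each of the orders `yzx` and `zyx`. -/
def centristProfile (b c : ℕ) : Profile 3 ((b + b) + (c + c)) :=
  Fin.append
    (Fin.append (fun _ : Fin b => Equiv.swap 0 1) (fun _ : Fin b => finRotate 3))
    (Fin.append (fun _ : Fin c => (finRotate 3).symm) (fun _ : Fin c => Equiv.swap 0 2))

/-- Summing over the voters of `centristProfile b c` groups them by their preference order. -/
theorem sum_centristProfile {M : Type*} [AddCommMonoid M] (b c : ℕ) (g : (Fin 3 ≃ Fin 3) → M) :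
    ∑ i, g (centristProfile b c i) =
      (b • g (Equiv.swap 0 1) + b • g (finRotate 3)) +
        (c • g (finRotate 3).symm + c • g (Equiv.swap 0 2)) := by
  simp only [centristProfile, Fin.sum_univ_add, Fin.append_left, Fin.append_right, sum_const,
    card_univ, Fintype.card_fin]

theorem score_centristProfile (b c : ℕ) (s : Fin 3 → ℝ) (v : Fin 3) :
    score s (centristProfile b c) v =
      (b * s (Equiv.swap 0 1 v) + b * s (finRotate 3 v)) +
        (c * s ((finRotate 3).symm v) + c * s (Equiv.swap 0 2 v)) := by
  simpa only [score, nsmul_eq_mul] using sum_centristProfile b c (fun σ => s (σ v))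

theorem condorcetLoser_centristProfile (b : ℕ) {c : ℕ} (hc : 0 < c) :
    CondorcetLoser (centristProfile b c) 0 := by
  intro v hv
  rw [card_filter, card_filter, sum_centristProfile b c (fun σ => if σ 0 ≤ σ v then 1 else 0),
    sum_centristProfile b c (fun σ => if σ v ≤ σ 0 then 1 else 0)]
  have r0 : (finRotate 3).symm 0 = 2 := by decide
  have r1 : (finRotate 3).symm 1 = 0 := by decide
  have r2 : (finRotate 3).symm 2 = 1 := by decide
  have w1 : Equiv.swap (0 : Fin 3) 1 2 = 2 := by decide
  have w2 : Equiv.swap (0 : Fin 3) 2 1 = 1 := by decide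
  fin_cases v
  · exact absurd rfl hv
  · simp [r0, r1, w2]
    omega
  · simp [r0, r2, w1]
    omega

/-- The margin of alternative `0` over any other alternative at `centristProfile b c`. -/
theorem score_centristProfile_sub {s : Fin 3 → ℝ} (hs : IsScoreVec s) (b c : ℕ) {v : Fin 3}
    (hv : v ≠ 0) :
    score s (centristProfile b c) 0 - score s (centristProfile b c) v =
      (2 * b - c) * s 1 - (b + c) := by
  have s0 : s 0 = 1 := hs.2.2.1 0 rfl
  have s2 : s 2 = 0 := hs.2.2.2 2 rfl
  have r0 : (finRotate 3).symm 0 = 2 := by decide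
  have r1 : (finRotate 3).symm 1 = 0 := by decide
  have r2 : (finRotate 3).symm 2 = 1 := by decide
  have w1 : Equiv.swap (0 : Fin 3) 1 2 = 2 := by decide
  have w2 : Equiv.swap (0 : Fin 3) 2 1 = 1 := by decide
  rw [score_centristProfile, score_centristProfile]
  fin_cases v
  · exact absurd rfl hv
  · simp [r0, r1, w2, s0, s2]
    ring
  · simp [r0, r2, w1, s0, s2]
    ring

/-- Three-alternative case. -/
theorem three_case_A
    (s s' : Fin 3 → ℝ) (hs : IsScoreVec s) (hs' : IsScoreVec s')
    (h1 : 1/2 ≤ s' 1) (h2 : s' 1 < s 1) (h3 : s 1 ≤ 1) :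
    ∃ n : ℕ, 0 < n ∧ ∃ P : Profile 3 n,
      CondorcetLoser P 0 ∧
      winners s P = {(0 : Fin 3)} ∧
      (0 : Fin 3) ∉ winners s' P := by
  obtain ⟨r, hr', hr⟩ := exists_rat_btwn h2
  obtain ⟨p, q, hq, rfl⟩ : ∃ p q : ℕ, 0 < q ∧ r = p / q := by
    have hr0 : 0 < r := by exact_mod_cast (by linarith : (0 : ℝ) < r)
    refine ⟨r.num.toNat, r.den, r.pos, ?_⟩
    have hnum : ((r.num.toNat : ℤ) : ℚ) = r.num := by
      rw [Int.toNat_of_nonneg (Rat.num_nonneg.2 hr0.le)]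
    rw [← Int.cast_natCast r.num.toNat, hnum, Rat.num_div_den]
  push_cast at hr hr'
  have hq' : (0 : ℝ) < q := by exact_mod_cast hq
  rw [div_lt_iff₀ hq'] at hr
  rw [lt_div_iff₀ hq'] at hr'
  have hpq : q < 2 * p := by
    have : (q : ℝ) < 2 * p := by nlinarith
    exact_mod_cast this
  -- With these group sizes, the margin of `0` under a score vector `t` is `3 * (q * t 1 - p)`.
  obtain ⟨c, hc⟩ : ∃ c, 2 * p = q + c := ⟨2 * p - q, by omega⟩
  have hcR : (2 : ℝ) * p = q + c := by exact_mod_cast hc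
  have margin (t : Fin 3 → ℝ) (ht : IsScoreVec t) (v : Fin 3) (hv : v ≠ 0) :
      score t (centristProfile (p + q) c) 0 - score t (centristProfile (p + q) c) v =
        3 * (t 1 * q - p) := by
    rw [score_centristProfile_sub ht _ _ hv]
    push_cast
    linear_combination (t 1 + 1) * hcR
  refine ⟨_, by omega, centristProfile (p + q) c, condorcetLoser_centristProfile _ (by omega),
    ?_, fun h => ?_⟩
  · ext v
    constructor
    · intro h
      by_contra hv
      linarith [h 0, margin s hs v hv]
    · rintro rfl v
      rcases eq_or_ne v 0 with rfl | hv
      · exact le_rfl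
      · linarith [margin s hs v hv]
  · linarith [h 1, margin s' hs' 1 (by decide)]
end

section
/- Let s and s' be score vectors for three alternatives with 1/2 < s(2) < s'(2) ≤ 1. Then there exists a preference profile ≿ on {x, y, z} such that x is a Condorcet loser at ≿, f^s(≿) = {x}, and x ∉ f^{s'}(≿). -/
open Finset

/-- For prescribed multiplicities `c j` of linear orders `σ j` there is a profile in which
each `σ j` is held by exactly `c j` voters. -/
theorem exists_profile_sum_eq_s7 {m k : ℕ} (c : Fin k → ℕ) (σ : Fin k → (Fin m ≃ Fin m)) :
    ∃ P : Profile m (∑ j, c j), ∀ {M : Type} [AddCommMonoid M] (f : (Fin m ≃ Fin m) → M),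
      ∑ i, f (P i) = ∑ j, c j • f (σ j) := by
  refine ⟨fun i => σ (finSigmaFinEquiv.symm i).1, fun f => ?_⟩
  rw [finSigmaFinEquiv.symm.sum_comp (fun a : (j : Fin k) × Fin (c j) => f (σ a.1)),
    Fintype.sum_sigma]
  simp

/-- Between two reals `0 ≤ a < b` there is a ratio `k / m` of natural numbers. -/
theorem exists_nat_ratio_btwn {a b : ℝ} (ha : 0 ≤ a) (hab : a < b) :
    ∃ k m : ℕ, (0 : ℝ) < m ∧ a * m < k ∧ (k : ℝ) < b * m := by
  obtain ⟨q, hq, hq'⟩ := exists_rat_btwn hab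
  have hden : (0 : ℝ) < q.den := by exact_mod_cast q.pos
  have hnum : ((q.num.toNat : ℤ) : ℝ) = q.num := by
    rw [Int.toNat_of_nonneg (Rat.num_nonneg.2 (by exact_mod_cast (ha.trans_lt hq).le))]
  rw [Rat.cast_def, ← hnum, Int.cast_natCast] at hq hq'
  exact ⟨q.num.toNat, q.den, hden, (lt_div_iff₀ hden).1 hq, (div_lt_iff₀ hden).1 hq'⟩

/-- Three-alternative case. -/
theorem three_case_B
    (s s' : Fin 3 → ℝ) (hs : IsScoreVec s) (hs' : IsScoreVec s')
    (h1 : 1/2 < s 1) (h2 : s 1 < s' 1) (h3 : s' 1 ≤ 1) :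
    ∃ n : ℕ, 0 < n ∧ ∃ P : Profile 3 n,
      CondorcetLoser P 0 ∧
      winners s P = {(0 : Fin 3)} ∧
      (0 : Fin 3) ∉ winners s' P := by
  obtain ⟨k, m, hden, hq, hq'⟩ := exists_nat_ratio_btwn (by linarith : 0 ≤ s 1) h2
  obtain ⟨B, hB⟩ := exists_nat_gt ((m : ℝ) / (2 * s 1 - 1))
  rw [div_lt_iff₀ (by linarith)] at hB
  have hkm : k < m := by
    have : (k : ℝ) < m := by nlinarith
    exact_mod_cast this
  have s0 : s 0 = 1 := hs.2.2.1 0 rfl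
  have s2 : s 2 = 0 := hs.2.2.2 2 rfl
  have s0' : s' 0 = 1 := hs'.2.2.1 0 rfl
  have s2' : s' 2 = 0 := hs'.2.2.2 2 rfl
  obtain ⟨P, hP⟩ := exists_profile_sum_eq_s7 ![B, k, B, B, B + m]
    ![Equiv.refl (Fin 3), Equiv.swap 1 2, Equiv.swap 0 1, finRotate 3, Equiv.swap 0 2]
  have swap120 : Equiv.swap (1 : Fin 3) 2 0 = 0 := by decide
  have swap012 : Equiv.swap (0 : Fin 3) 1 2 = 2 := by decide
  have swap021 : Equiv.swap (0 : Fin 3) 2 1 = 1 := by decide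
  have rot0 : finRotate 3 0 = 1 := by decide
  have rot1 : finRotate 3 1 = 2 := by decide
  have rot2 : finRotate 3 2 = 0 := by decide
  have score_eq (r : Fin 3 → ℝ) (x : Fin 3) := hP fun p => r (p x)
  have card_eq (x y : Fin 3) := hP fun p => if p x ≤ p y then 1 else 0
  simp only [Fin.sum_univ_five, nsmul_eq_mul] at score_eq card_eq
  have hk : (0 : ℝ) ≤ k := k.cast_nonneg
  have y_lt_x : score s P 1 < score s P 0 := by
    simp [score, score_eq, s0, s2, swap120, swap021, rot0, rot1]
    nlinarith
  have z_lt_x : score s P 2 < score s P 0 := by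
    simp [score, score_eq, s0, s2, swap120, swap012, rot0, rot2]
    nlinarith
  have x_lt_y : score s' P 0 < score s' P 1 := by
    simp [score, score_eq, s0', s2', swap120, swap021, rot0, rot1]
    nlinarith
  refine ⟨_, ?_, P, ?_, ?_, fun h => (h 1).not_gt x_lt_y⟩
  · simp [Fin.sum_univ_five]
    omega
  · intro y hy
    rw [card_filter, card_filter, card_eq, card_eq]
    fin_cases y
    · exact absurd rfl hy
    · simp [swap120, swap021, rot0, rot1]
      omega
    · simp [swap120, swap012, rot0, rot2]
      omega
  · ext x
    refine ⟨fun h => ?_, ?_⟩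
    · fin_cases x
      · rfl
      · exact absurd (h 0) y_lt_x.not_ge
      · exact absurd (h 0) z_lt_x.not_ge
    · rintro rfl y
      fin_cases y
      exacts [le_rfl, y_lt_x.le, z_lt_x.le]
end

section
/- Let s and s' be score vectors for three alternatives with 0 ≤ s(2) < 1/2 ≤ s'(2) ≤ 1. Then there exists a preference profile ≿ on {x, y, z} such that x is a Condorcet loser at ≿, f^s(≿) = {x}, and x ∉ f^{s'}(≿). -/
open Finset

/-- The profile in which `k` voters rank `0, 1, 2`, `k` voters rank `0, 2, 1`, `k + 1` voters
rank `1, 2, 0` and `k + 1` voters rank `2, 1, 0`. -/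
noncomputable def polarizedProfile (k : ℕ) :
    Profile 3 (Fintype.card ((Fin k ⊕ Fin k) ⊕ (Fin (k + 1) ⊕ Fin (k + 1)))) :=
  fun i => Sum.elim
    (Sum.elim (fun _ => Equiv.refl (Fin 3)) (fun _ => Equiv.swap 1 2))
    (Sum.elim (fun _ => (finRotate 3).symm) (fun _ => Equiv.swap 0 2))
    ((Fintype.equivFin ((Fin k ⊕ Fin k) ⊕ (Fin (k + 1) ⊕ Fin (k + 1)))).symm i)

theorem sum_polarizedProfile {M : Type*} [AddCommMonoid M] (k : ℕ) (f : (Fin 3 ≃ Fin 3) → M) :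
    ∑ i, f (polarizedProfile k i) =
      (k • f (Equiv.refl (Fin 3)) + k • f (Equiv.swap 1 2)) +
        ((k + 1) • f (finRotate 3).symm + (k + 1) • f (Equiv.swap 0 2)) := by
  unfold polarizedProfile
  rw [Equiv.sum_comp (Fintype.equivFin ((Fin k ⊕ Fin k) ⊕ (Fin (k + 1) ⊕ Fin (k + 1)))).symm
    (fun j => f (Sum.elim
      (Sum.elim (fun _ => Equiv.refl (Fin 3)) (fun _ => Equiv.swap 1 2))
      (Sum.elim (fun _ => (finRotate 3).symm) (fun _ => Equiv.swap 0 2)) j))]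
  simp only [Fintype.sum_sum_type, Sum.elim_inl, Sum.elim_inr, sum_const, card_univ,
    Fintype.card_fin]

theorem condorcetLoser_polarizedProfile (k : ℕ) : CondorcetLoser (polarizedProfile k) 0 := by
  intro y hy
  rw [card_filter, card_filter,
    sum_polarizedProfile k (fun p => if p 0 ≤ p y then 1 else 0),
    sum_polarizedProfile k (fun p => if p y ≤ p 0 then 1 else 0)]
  have hy' : y = 1 ∨ y = 2 := by omega
  rcases hy' with rfl | rfl <;>
    simp [Equiv.swap_apply_def, show (finRotate 3).symm 0 = 2 by decide,
      show (finRotate 3).symm 1 = 0 by decide, show (finRotate 3).symm 2 = 1 by decide] <;>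
    omega

theorem score_polarizedProfile_zero {s : Fin 3 → ℝ} (hs : IsScoreVec s) (k : ℕ) :
    score s (polarizedProfile k) 0 = 2 * k := by
  have h0 : s 0 = 1 := hs.2.2.1 0 rfl
  have h2 : s 2 = 0 := hs.2.2.2 2 rfl
  rw [score, sum_polarizedProfile k (fun p => s (p 0))]
  simp [Equiv.swap_apply_def, show (finRotate 3).symm 0 = 2 by decide, h0, h2]
  ring

theorem score_polarizedProfile_of_ne_zero {s : Fin 3 → ℝ} (hs : IsScoreVec s) (k : ℕ)
    {y : Fin 3} (hy : y ≠ 0) :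
    score s (polarizedProfile k) y = (k + 1) + (2 * k + 1) * s 1 := by
  have h0 : s 0 = 1 := hs.2.2.1 0 rfl
  have h2 : s 2 = 0 := hs.2.2.2 2 rfl
  have hy' : y = 1 ∨ y = 2 := by omega
  rw [score, sum_polarizedProfile k (fun p => s (p y))]
  rcases hy' with rfl | rfl <;>
    simp [Equiv.swap_apply_def, show (finRotate 3).symm 1 = 0 by decide,
      show (finRotate 3).symm 2 = 1 by decide, h0, h2] <;>
    ring

/-- Three-alternative case. -/
theorem three_case_C
    (s s' : Fin 3 → ℝ) (hs : IsScoreVec s) (hs' : IsScoreVec s')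
    (h1 : 0 ≤ s 1) (h2 : s 1 < 1/2) (h3 : 1/2 ≤ s' 1) (h4 : s' 1 ≤ 1) :
    ∃ n : ℕ, 0 < n ∧ ∃ P : Profile 3 n,
      CondorcetLoser P 0 ∧
      winners s P = {(0 : Fin 3)} ∧
      (0 : Fin 3) ∉ winners s' P := by
  obtain ⟨k, hk⟩ := exists_nat_gt (2 / (1 - 2 * s 1))
  rw [div_lt_iff₀ (by linarith)] at hk
  have hlt : ∀ y : Fin 3, y ≠ 0 →
      score s (polarizedProfile k) y < score s (polarizedProfile k) 0 := by
    intro y hy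
    rw [score_polarizedProfile_of_ne_zero hs k hy, score_polarizedProfile_zero hs k]
    linarith
  refine ⟨_, ?_, polarizedProfile k, condorcetLoser_polarizedProfile k, ?_, ?_⟩
  · exact Fintype.card_pos
  · ext x
    rw [Set.mem_singleton_iff]
    constructor
    · intro hx
      by_contra hne
      exact (hlt x hne).not_ge (hx 0)
    · rintro rfl y
      by_cases hy : y = 0
      · rw [hy]
      · exact (hlt y hy).le
  · intro hx
    have h := hx 1
    rw [score_polarizedProfile_of_ne_zero hs' k (by decide), score_polarizedProfile_zero hs' k] at h
    nlinarith [(Nat.cast_nonneg k : (0 : ℝ) ≤ k)]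
end

section
/- Let s and s' be score vectors for three alternatives with 0 ≤ s'(2) ≤ 1/2 < s(2) ≤ 1. Then there exists a preference profile ≿ on {x, y, z} such that x is a Condorcet loser at ≿, f^s(≿) = {x}, and x ∉ f^{s'}(≿). -/
open Finset

/-- With alternatives `x, y, z = 0, 1, 2`: `b` voters with `y ≻ x ≻ z`, `b` voters with
`z ≻ x ≻ y`, one voter with `y ≻ z ≻ x` and one voter with `z ≻ y ≻ x`. -/
def middleProfile (b : ℕ) : Profile 3 (b + (b + 2)) :=
  Fin.append (fun _ => Equiv.swap 0 1)
    (Fin.append (fun _ => finRotate 3) ![(finRotate 3).symm, Equiv.swap 0 2])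

theorem sum_middleProfile {M : Type*} [AddCommMonoid M] (b : ℕ) (g : (Fin 3 ≃ Fin 3) → M) :
    ∑ i, g (middleProfile b i) =
      b • g (Equiv.swap 0 1) +
        (b • g (finRotate 3) + (g (finRotate 3).symm + g (Equiv.swap 0 2))) := by
  simp [middleProfile, Fin.sum_univ_add]

theorem condorcetLoser_middleProfile (b : ℕ) : CondorcetLoser (middleProfile b) 0 := by
  intro y hy
  rw [Finset.card_filter, Finset.card_filter,
    sum_middleProfile b (fun e => if e 0 ≤ e y then 1 else 0),
    sum_middleProfile b (fun e => if e y ≤ e 0 then 1 else 0)]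
  fin_cases y
  · exact absurd rfl hy
  all_goals simp +decide

theorem score_middleProfile_zero {s : Fin 3 → ℝ} (hs : IsScoreVec s) (b : ℕ) :
    score s (middleProfile b) 0 = 2 * b * s 1 := by
  have hlast : s 2 = 0 := hs.2.2.2 2 rfl
  rw [score, sum_middleProfile b (fun e => s (e 0)),
    show (Equiv.swap 0 1 : Fin 3 ≃ Fin 3) 0 = 1 by decide, show finRotate 3 0 = 1 by decide,
    show (finRotate 3).symm 0 = 2 by decide,
    show (Equiv.swap 0 2 : Fin 3 ≃ Fin 3) 0 = 2 by decide, hlast]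
  simp only [nsmul_eq_mul]
  ring

theorem score_middleProfile_of_ne_zero {s : Fin 3 → ℝ} (hs : IsScoreVec s) (b : ℕ)
    {y : Fin 3} (hy : y ≠ 0) : score s (middleProfile b) y = b + 1 + s 1 := by
  have hfirst : s 0 = 1 := hs.2.2.1 0 rfl
  have hlast : s 2 = 0 := hs.2.2.2 2 rfl
  rw [score, sum_middleProfile b (fun e => s (e y))]
  obtain rfl | rfl : y = 1 ∨ y = 2 := by lia
  · rw [show (Equiv.swap 0 1 : Fin 3 ≃ Fin 3) 1 = 0 by decide, show finRotate 3 1 = 2 by decide,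
      show (finRotate 3).symm 1 = 0 by decide,
      show (Equiv.swap 0 2 : Fin 3 ≃ Fin 3) 1 = 1 by decide, hfirst, hlast]
    simp only [nsmul_eq_mul]
    ring
  · rw [show (Equiv.swap 0 1 : Fin 3 ≃ Fin 3) 2 = 2 by decide, show finRotate 3 2 = 0 by decide,
      show (finRotate 3).symm 2 = 1 by decide,
      show (Equiv.swap 0 2 : Fin 3 ≃ Fin 3) 2 = 0 by decide, hfirst, hlast]
    simp only [nsmul_eq_mul]
    ring

/-- Three-alternative case. -/
theorem three_case_D
    (s s' : Fin 3 → ℝ) (hs : IsScoreVec s) (hs' : IsScoreVec s')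
    (h1 : 0 ≤ s' 1) (h2 : s' 1 ≤ 1/2) (h3 : 1/2 < s 1) (h4 : s 1 ≤ 1) :
    ∃ n : ℕ, 0 < n ∧ ∃ P : Profile 3 n,
      CondorcetLoser P 0 ∧
      winners s P = {(0 : Fin 3)} ∧
      (0 : Fin 3) ∉ winners s' P := by
  obtain ⟨b, hb⟩ := exists_nat_gt (2 / (2 * s 1 - 1))
  rw [div_lt_iff₀ (by linarith)] at hb
  have hlt : ∀ y ≠ 0, score s (middleProfile b) y < score s (middleProfile b) 0 := by
    intro y hy
    rw [score_middleProfile_zero hs, score_middleProfile_of_ne_zero hs b hy]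
    linarith
  refine ⟨b + (b + 2), by lia, middleProfile b, condorcetLoser_middleProfile b, ?_, ?_⟩
  · ext v
    constructor
    · intro hv
      by_contra hne
      exact (hlt v hne).not_ge (hv 0)
    · rintro rfl y
      rcases eq_or_ne y 0 with rfl | hy
      · exact le_rfl
      · exact (hlt y hy).le
  · intro h
    have hle := h 1
    rw [score_middleProfile_zero hs', score_middleProfile_of_ne_zero hs' b one_ne_zero] at hle
    have := mul_le_mul_of_nonneg_left h2 (Nat.cast_nonneg (α := ℝ) b)
    linarith
end

section
/- Let m ≥ 4 and let s be an m-dimensional score vector that is not the Borda score vector s^B. Then at most one of the following three equalities holds: (i) s_{−1} equals the Borda score vector for m−1 alternatives; (ii) s_{−m} equals the Borda score vector for m−1 alternatives; (iii) s_ave equals the Borda score vector for 3 alternatives, i.e. (1/(m−2)) ∑_{k=2}^{m−1} s(k) = 1/2. -/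
open Finset

/-- `s₋₁`: remove the first coordinate of `s` and renormalize by `s(2)`
(the all-zero vector if `s(2) = 0`). -/
noncomputable def sMinus1 {m : ℕ} (s : Fin m → ℝ) : Fin (m - 1) → ℝ :=
  fun j =>
    if s ⟨1, by have := j.isLt; omega⟩ = 0 then 0
    else s ⟨(j : ℕ) + 1, by have := j.isLt; omega⟩ / s ⟨1, by have := j.isLt; omega⟩

/-- `s₋ₘ`: remove the last coordinate of `s` and renormalize by `1 - s(m-1)`
(the all-one vector if `s(m-1) = 1`). -/
noncomputable def sMinusM {m : ℕ} (s : Fin m → ℝ) : Fin (m - 1) → ℝ :=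
  fun j =>
    if s ⟨m - 2, by have := j.isLt; omega⟩ = 1 then 1
    else (s ⟨(j : ℕ), by have := j.isLt; omega⟩ - s ⟨m - 2, by have := j.isLt; omega⟩) /
      (1 - s ⟨m - 2, by have := j.isLt; omega⟩)

/-- `s_ave = (1, (1/(m-2)) ∑_{k=2}^{m-1} s(k), 0)` (1-indexed sum bounds). -/
noncomputable def sAve {m : ℕ} (s : Fin m → ℝ) : Fin 3 → ℝ :=
  ![1, (∑ k : Fin m, if 1 ≤ (k : ℕ) ∧ (k : ℕ) ≤ m - 2 then s k else 0) / ((m : ℝ) - 2), 0]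

theorem sum_interior_affine (n : ℕ) (s : Fin (n + 2) → ℝ) (c d : ℝ)
    (h : ∀ k : Fin (n + 2), 1 ≤ (k : ℕ) → (k : ℕ) ≤ n → s k = c + d * (k : ℕ)) :
    (∑ k : Fin (n + 2), if 1 ≤ (k : ℕ) ∧ (k : ℕ) ≤ n then s k else 0) =
      n * c + d * (n * (n + 1) / 2) := by
  have gauss : ∀ p : ℕ, ∑ i ∈ range p, (c + d * ((i : ℝ) + 1)) =
      p * c + d * (p * (p + 1) / 2) := by
    intro p
    induction p with
    | zero => simp
    | succ p ih => rw [sum_range_succ, ih]; push_cast; ring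
  rw [← gauss n, Fin.sum_univ_succ, Fin.sum_univ_castSucc, ← Fin.sum_univ_eq_sum_range
    (fun i => c + d * ((i : ℝ) + 1))]
  rw [if_neg (by simp), if_neg (by simp), zero_add, add_zero]
  refine sum_congr rfl fun i _ => ?_
  rw [if_pos (by simp), h _ (by simp) (by simp)]
  simp

/-- If the interior entries of `s` are affine in the rank and `s_ave` is the Borda vector, the
affine function takes the value `1/2` at the middle rank. -/
theorem affine_midpoint_of_sAve_eq_borda (n : ℕ) (hn : 2 ≤ n) (s : Fin (n + 2) → ℝ) (c d : ℝ)
    (h : ∀ k : Fin (n + 2), 1 ≤ (k : ℕ) → (k : ℕ) ≤ n → s k = c + d * (k : ℕ))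
    (hA : sAve s = bordaVec 3) : c + d * ((n + 1) / 2) = 1 / 2 := by
  have hn0 : (n : ℝ) ≠ 0 := by positivity
  have h1 := congrFun hA 1
  simp only [sAve, bordaVec, Matrix.cons_val_one, Matrix.cons_val_zero, Nat.add_sub_cancel,
    sum_interior_affine n s c d h] at h1
  push_cast at h1
  norm_num at h1
  field_simp at h1 ⊢
  linarith

theorem eq_of_sMinus1_eq_borda (n : ℕ) (hn : 2 ≤ n) (s : Fin (n + 2) → ℝ)
    (h : sMinus1 s = bordaVec (n + 2 - 1)) (k : Fin (n + 2)) (hk : 1 ≤ (k : ℕ)) :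
    s k = s ⟨1, by omega⟩ * (n + 1 - (k : ℕ)) / n := by
  have hn0 : (n : ℝ) ≠ 0 := by positivity
  have hne : s ⟨1, by omega⟩ ≠ 0 := by
    intro h0
    have := congrFun h ⟨0, by omega⟩
    simp only [sMinus1, bordaVec, if_pos h0] at this
    simp [hn0] at this
  obtain ⟨j, hj⟩ : ∃ j, (k : ℕ) = j + 1 := ⟨k - 1, by omega⟩
  have hk' := k.isLt
  have hkj : k = ⟨j + 1, by omega⟩ := Fin.ext hj
  have h1 := congrFun h ⟨j, by omega⟩
  simp only [sMinus1, bordaVec, if_neg hne, ← hkj] at h1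
  rw [div_eq_iff hne] at h1
  have hm : ((n + 2 - 1 : ℕ) : ℝ) - 1 = n := by simp
  rw [h1, hj, hm]
  push_cast
  ring

theorem eq_of_sMinusM_eq_borda (n : ℕ) (hn : 2 ≤ n) (s : Fin (n + 2) → ℝ)
    (h : sMinusM s = bordaVec (n + 2 - 1)) (k : Fin (n + 2)) (hk : (k : ℕ) ≤ n) :
    s k = s ⟨n, by omega⟩ + (1 - s ⟨n, by omega⟩) * (n - (k : ℕ)) / n := by
  have hn0 : (n : ℝ) ≠ 0 := by positivity
  have hne : s ⟨n, by omega⟩ ≠ 1 := by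
    intro h0
    have := congrFun h ⟨n, by omega⟩
    simp [sMinusM, bordaVec, h0] at this
  have hne' : 1 - s ⟨n, by omega⟩ ≠ 0 := sub_ne_zero.2 hne.symm
  have h1 := congrFun h ⟨k, by omega⟩
  simp only [sMinusM, bordaVec, Nat.add_sub_cancel, if_neg hne] at h1
  rw [div_eq_iff hne', sub_eq_iff_eq_add] at h1
  have hm : ((n + 2 - 1 : ℕ) : ℝ) - 1 = n := by simp
  rw [h1, hm]
  ring

theorem eq_borda_of_sMinus1 (n : ℕ) (hn : 2 ≤ n) (s : Fin (n + 2) → ℝ) (hs : IsScoreVec s)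
    (h : sMinus1 s = bordaVec (n + 2 - 1)) (ha : s ⟨1, by omega⟩ * (n + 1) = n) :
    s = bordaVec (n + 2) := by
  have hn0 : (n : ℝ) ≠ 0 := by positivity
  have hn1 : (n : ℝ) + 1 ≠ 0 := by positivity
  have hm : ((n + 2 : ℕ) : ℝ) - 1 = n + 1 := by push_cast; ring
  funext k
  simp only [bordaVec, hm]
  rcases Nat.eq_zero_or_pos (k : ℕ) with hk | hk
  · rw [hs.2.2.1 k hk, hk]
    simp [hn1]
  · rw [eq_of_sMinus1_eq_borda n hn s h k hk, div_eq_div_iff hn0 hn1]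
    linear_combination ((n : ℝ) + 1 - (k : ℕ)) * ha

theorem eq_borda_of_sMinusM (n : ℕ) (hn : 2 ≤ n) (s : Fin (n + 2) → ℝ) (hs : IsScoreVec s)
    (h : sMinusM s = bordaVec (n + 2 - 1)) (hb : s ⟨n, by omega⟩ * (n + 1) = 1) :
    s = bordaVec (n + 2) := by
  have hn0 : (n : ℝ) ≠ 0 := by positivity
  have hn1 : (n : ℝ) + 1 ≠ 0 := by positivity
  have hm : ((n + 2 : ℕ) : ℝ) - 1 = n + 1 := by push_cast; ring
  funext k
  simp only [bordaVec, hm]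
  rcases Nat.lt_or_ge n (k : ℕ) with hk | hk
  · have hk1 : (k : ℕ) = n + 1 := by omega
    rw [hs.2.2.2 k (by omega), hk1]
    simp
  · rw [eq_of_sMinusM_eq_borda n hn s h k hk, eq_div_iff hn1]
    field_simp
    linear_combination (k : ℝ) * hb

/-- At most one of `s₋₁`, `s₋ₘ`, `s_ave` can equal the corresponding Borda
score vector, when `s` itself is not the Borda score vector. -/
theorem at_most_one_borda_reduction
    (m : ℕ) (hm : 4 ≤ m) (s : Fin m → ℝ) (hs : IsScoreVec s)
    (hsB : s ≠ bordaVec m) :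
    ¬ (sMinus1 s = bordaVec (m - 1) ∧ sMinusM s = bordaVec (m - 1)) ∧
    ¬ (sMinus1 s = bordaVec (m - 1) ∧ sAve s = bordaVec 3) ∧
    ¬ (sMinusM s = bordaVec (m - 1) ∧ sAve s = bordaVec 3) := by
  obtain ⟨n, rfl⟩ : ∃ n, m = n + 2 := ⟨m - 2, by omega⟩
  have hn : 2 ≤ n := by omega
  have hn0 : (n : ℝ) ≠ 0 := by positivity
  have hn1 : (n : ℝ) - 1 ≠ 0 := by
    have : (2 : ℝ) ≤ n := by exact_mod_cast hn
    linarith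
  refine ⟨fun ⟨h1, hM⟩ => hsB ?_, fun ⟨h1, hA⟩ => hsB ?_, fun ⟨hM, hA⟩ => hsB ?_⟩
  · apply eq_borda_of_sMinus1 n hn s hs h1
    have hb := eq_of_sMinus1_eq_borda n hn s h1 ⟨n, by omega⟩ (by simp; omega)
    have ha := eq_of_sMinusM_eq_borda n hn s hM ⟨1, by omega⟩ (by simp; omega)
    rw [hb] at ha
    field_simp at ha
    push_cast at ha
    apply mul_left_cancel₀ hn1
    linear_combination ha
  · apply eq_borda_of_sMinus1 n hn s hs h1
    have := affine_midpoint_of_sAve_eq_borda n hn s (s ⟨1, by omega⟩ * (n + 1) / n)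
      (-(s ⟨1, by omega⟩ / n)) (fun k hk _ => by
        rw [eq_of_sMinus1_eq_borda n hn s h1 k hk]; ring) hA
    field_simp at this
    linear_combination this
  · apply eq_borda_of_sMinusM n hn s hs hM
    have := affine_midpoint_of_sAve_eq_borda n hn s 1 (-((1 - s ⟨n, by omega⟩) / n)) (fun k _ hk => by
        rw [eq_of_sMinusM_eq_borda n hn s hM k hk]; field_simp; ring) hA
    field_simp at this
    linear_combination this
end

section
/- Let m ≥ 4, let s be an m-dimensional score vector that is not the Borda score vector, and let s' ≠ s be an m-dimensional score vector. Suppose it is not the case that both s(2) = s(m−1) = 1/2 and s'(2) = s'(m−1). Then at least one of the following holds: (i) s_{−1} and s'_{−1} are score vectors for m−1 alternatives, s_{−1} is not the Borda score vector for m−1 alternatives, and s_{−1} ≠ s'_{−1}; (ii) s_{−m} and s'_{−m} are score vectors for m−1 alternatives, s_{−m} is not the Borda score vector for m−1 alternatives, and s_{−m} ≠ s'_{−m}; (iii) s_ave and s'_ave are score vectors for 3 alternatives, s_ave ≠ (1, 1/2, 0), and s_ave ≠ s'_ave. -/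
open Finset

/-- The mean of the entries of `s` other than the first and the last. -/
noncomputable def midMean {m : ℕ} (s : Fin m → ℝ) : ℝ :=
  (∑ k : Fin m, if 1 ≤ (k : ℕ) ∧ (k : ℕ) ≤ m - 2 then s k else 0) / ((m : ℝ) - 2)

lemma midMean_congr {m : ℕ} {s t : Fin m → ℝ}
    (h : ∀ k : Fin m, 1 ≤ (k : ℕ) → (k : ℕ) ≤ m - 2 → s k = t k) : midMean s = midMean t := by
  unfold midMean
  congr 1
  refine Finset.sum_congr rfl fun k _ => ?_
  split_ifs with hk
  · exact h k hk.1 hk.2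
  · rfl

lemma midMean_one {m : ℕ} (hm : 4 ≤ m) : midMean (fun _ : Fin m => (1 : ℝ)) = 1 := by
  obtain ⟨n, rfl⟩ : ∃ n, m = n + 2 := ⟨m - 2, by omega⟩
  unfold midMean
  have h : (∑ k : Fin (n + 2),
      if 1 ≤ (k : ℕ) ∧ (k : ℕ) ≤ n + 2 - 2 then (1 : ℝ) else 0) = n := by
    rw [Fin.sum_univ_eq_sum_range
      (fun k => if 1 ≤ k ∧ k ≤ n + 2 - 2 then (1 : ℝ) else 0) (n + 2),
      Finset.sum_range_succ', Finset.sum_range_succ]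
    rw [Finset.sum_congr rfl (g := fun _ => (1 : ℝ))]
    · simp
    · intro k hk
      rw [Finset.mem_range] at hk
      rw [if_pos (by omega)]
  rw [h]
  have hn : (2 : ℝ) ≤ n := by exact_mod_cast (by omega : 2 ≤ n)
  push_cast
  rw [add_sub_cancel_right]
  exact div_self (by linarith)

lemma midMean_const_mul {m : ℕ} (c : ℝ) (s : Fin m → ℝ) :
    midMean (fun k => c * s k) = c * midMean s := by
  unfold midMean
  rw [← mul_div_assoc, Finset.mul_sum]
  simp only [mul_ite, mul_zero]

lemma midMean_sub {m : ℕ} (s t : Fin m → ℝ) :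
    midMean (fun k => s k - t k) = midMean s - midMean t := by
  unfold midMean
  rw [← sub_div, ← Finset.sum_sub_distrib]
  congr 1
  refine Finset.sum_congr rfl fun k _ => ?_
  split_ifs <;> simp

lemma midMean_one_sub {m : ℕ} (hm : 4 ≤ m) (s : Fin m → ℝ) :
    midMean (fun k => 1 - s k) = 1 - midMean s := by
  rw [midMean_sub (fun _ => 1) s, midMean_one hm]

lemma midMean_const {m : ℕ} (hm : 4 ≤ m) (c : ℝ) : midMean (fun _ : Fin m => c) = c := by
  simpa [midMean_one hm] using midMean_const_mul c (fun _ : Fin m => (1 : ℝ))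

lemma midMean_bordaVec {m : ℕ} (hm : 4 ≤ m) : midMean (bordaVec m) = 1 / 2 := by
  have hm' : (4 : ℝ) ≤ m := by exact_mod_cast hm
  have h : midMean (bordaVec m) = midMean (fun k => 1 - bordaVec m k) := by
    unfold midMean
    congr 1
    rw [← Equiv.sum_comp Fin.revPerm]
    refine Finset.sum_congr rfl fun k _ => ?_
    have hk := k.isLt
    have hv : ((Fin.revPerm k : Fin m) : ℕ) = m - (k + 1) := by simp [Fin.val_rev]
    have hb : bordaVec m (Fin.revPerm k) = 1 - bordaVec m k := by
      unfold bordaVec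
      rw [hv, Nat.cast_sub (by omega)]
      have : (m : ℝ) - 1 ≠ 0 := by linarith
      field_simp
      push_cast
      ring
    rw [hb, hv]
    by_cases hc : 1 ≤ (k : ℕ) ∧ (k : ℕ) ≤ m - 2
    · rw [if_pos hc, if_pos (by omega)]
    · rw [if_neg hc, if_neg (by omega)]
  rw [midMean_one_sub hm] at h
  linarith

lemma midMean_nonneg {m : ℕ} (hm : 4 ≤ m) {s : Fin m → ℝ} (hs : ∀ k, 0 ≤ s k) :
    0 ≤ midMean s := by
  have hm' : (4 : ℝ) ≤ m := by exact_mod_cast hm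
  refine div_nonneg (Finset.sum_nonneg fun k _ => ?_) (by linarith)
  split_ifs
  exacts [hs k, le_rfl]

lemma eq_zero_of_midMean_eq_zero {m : ℕ} (hm : 4 ≤ m) {s : Fin m → ℝ} (hs : ∀ k, 0 ≤ s k)
    (h : midMean s = 0) (k : Fin m) (h1 : 1 ≤ (k : ℕ)) (h2 : (k : ℕ) ≤ m - 2) : s k = 0 := by
  have hm' : (4 : ℝ) ≤ m := by exact_mod_cast hm
  have h0 := (div_eq_zero_iff.mp h).resolve_right (by linarith)
  rw [Finset.sum_eq_zero_iff_of_nonneg] at h0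
  · simpa [h1, h2] using h0 k (Finset.mem_univ k)
  · intro j _
    split_ifs
    exacts [hs j, le_rfl]

namespace IsScoreVec

variable {m : ℕ} {s t : Fin m → ℝ}

lemma ext_mid (hs : IsScoreVec s) (ht : IsScoreVec t)
    (h : ∀ k : Fin m, 1 ≤ (k : ℕ) → (k : ℕ) ≤ m - 2 → s k = t k) : s = t := by
  funext k
  have hk := k.isLt
  by_cases h0 : (k : ℕ) = 0
  · rw [hs.2.2.1 k h0, ht.2.2.1 k h0]
  by_cases h1 : (k : ℕ) = m - 1
  · rw [hs.2.2.2 k h1, ht.2.2.2 k h1]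
  exact h k (by omega) (by omega)

lemma sAve (hm : 4 ≤ m) (hs : IsScoreVec s) : IsScoreVec (sAve s) := by
  have h0 : 0 ≤ midMean s := midMean_nonneg hm fun k => (hs.2.1 k).1
  have h1 : 0 ≤ midMean (fun k => 1 - s k) :=
    midMean_nonneg hm fun k => sub_nonneg.mpr (hs.2.1 k).2
  rw [midMean_one_sub hm] at h1
  change IsScoreVec ![1, midMean s, 0]
  refine ⟨?_, ?_, ?_, ?_⟩
  · intro i j hij
    fin_cases i <;> fin_cases j <;> simp_all
  all_goals
    intro k
    fin_cases k <;> simp <;> try constructor <;> linarith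

lemma sMinus1 (hm : 4 ≤ m) {h₁ : 1 < m} (hs : IsScoreVec s) (h : s ⟨1, h₁⟩ ≠ 0) :
    IsScoreVec (sMinus1 s) := by
  have hpos : 0 < s ⟨1, h₁⟩ := lt_of_le_of_ne (hs.2.1 _).1 h.symm
  simp only [IsScoreVec, _root_.sMinus1, if_neg h]
  refine ⟨?_, ?_, ?_, ?_⟩
  · intro i j hij
    simp only [_root_.sMinus1, if_neg h]
    refine div_le_div_of_nonneg_right (hs.1 ?_) hpos.le
    exact Fin.mk_le_mk.mpr (Nat.succ_le_succ hij)
  · intro k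
    refine ⟨div_nonneg (hs.2.1 _).1 hpos.le, div_le_one_of_le₀ (hs.1 ?_) hpos.le⟩
    simp [Fin.le_def]
  · intro k hk
    simp only [hk, zero_add]
    exact div_self h
  · intro k hk
    rw [hs.2.2.2 _ (by dsimp only; omega), zero_div]

lemma sMinusM (hm : 4 ≤ m) {h₂ : m - 2 < m} (hs : IsScoreVec s) (h : s ⟨m - 2, h₂⟩ ≠ 1) :
    IsScoreVec (sMinusM s) := by
  have hpos : 0 < 1 - s ⟨m - 2, h₂⟩ :=
    sub_pos.mpr (lt_of_le_of_ne (hs.2.1 _).2 h)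
  simp only [IsScoreVec, _root_.sMinusM, if_neg h]
  refine ⟨?_, ?_, ?_, ?_⟩
  · intro i j hij
    simp only [_root_.sMinusM, if_neg h]
    refine div_le_div_of_nonneg_right (sub_le_sub_right (hs.1 ?_) _) hpos.le
    exact Fin.mk_le_mk.mpr hij
  · intro k
    refine ⟨div_nonneg (sub_nonneg.mpr (hs.1 ?_)) hpos.le,
      div_le_one_of_le₀ (sub_le_sub_right (hs.2.1 _).2 _) hpos.le⟩
    have := k.isLt
    simp only [Fin.le_def]
    omega
  · intro k hk
    rw [hs.2.2.1 _ hk]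
    exact div_self hpos.ne'
  · intro k hk
    have hk' : (k : ℕ) = m - 2 := by omega
    simp only [hk', sub_self, zero_div]

lemma eq_zero_of_second {h₁ : 1 < m} (hs : IsScoreVec s) (h : s ⟨1, h₁⟩ = 0)
    (k : Fin m) (hk : 1 ≤ (k : ℕ)) : s k = 0 :=
  le_antisymm (h ▸ hs.1 (by simpa [Fin.le_def] using hk)) (hs.2.1 k).1

lemma eq_one_of_penultimate {h₂ : m - 2 < m} (hs : IsScoreVec s) (h : s ⟨m - 2, h₂⟩ = 1)
    (k : Fin m) (hk : (k : ℕ) ≤ m - 2) : s k = 1 :=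
  le_antisymm (hs.2.1 k).2 (h ▸ hs.1 (by simpa [Fin.le_def] using hk))

lemma midMean_eq_zero_iff (hm : 4 ≤ m) {h₁ : 1 < m} (hs : IsScoreVec s) :
    midMean s = 0 ↔ s ⟨1, h₁⟩ = 0 := by
  refine ⟨fun h => eq_zero_of_midMean_eq_zero hm (fun k => (hs.2.1 k).1) h _ le_rfl
    (by dsimp only; omega), fun h => ?_⟩
  rw [midMean_congr (t := fun _ => 0) fun k hk _ => hs.eq_zero_of_second h k hk,
    midMean_const hm]

lemma midMean_eq_one_iff (hm : 4 ≤ m) {h₂ : m - 2 < m} (hs : IsScoreVec s) :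
    midMean s = 1 ↔ s ⟨m - 2, h₂⟩ = 1 := by
  refine ⟨fun h => ?_, fun h => ?_⟩
  · have := eq_zero_of_midMean_eq_zero hm (fun k => sub_nonneg.mpr (hs.2.1 k).2)
      (by rw [midMean_one_sub hm, h, sub_self]) ⟨m - 2, h₂⟩ (by dsimp only; omega) le_rfl
    linarith
  · rw [midMean_congr (t := fun _ => 1) fun k _ hk => hs.eq_one_of_penultimate h k hk,
      midMean_const hm]

lemma bordaVec (hm : 4 ≤ m) : IsScoreVec (bordaVec m) := by
  have hm' : (4 : ℝ) ≤ m := by exact_mod_cast hm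
  have hpos : (0 : ℝ) < m - 1 := by linarith
  have hlast (k : Fin m) : (k : ℝ) ≤ m - 1 := by
    have : ((k + 1 : ℕ) : ℝ) ≤ m := by exact_mod_cast k.isLt
    push_cast at this
    linarith
  unfold _root_.bordaVec
  refine ⟨?_, ?_, ?_, ?_⟩
  · intro i j hij
    have : ((i : ℕ) : ℝ) ≤ (j : ℕ) := by exact_mod_cast hij
    dsimp only
    exact div_le_div_of_nonneg_right (by linarith) hpos.le
  · intro k
    refine ⟨div_nonneg (sub_nonneg.mpr (hlast k)) hpos.le, div_le_one_of_le₀ ?_ hpos.le⟩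
    exact sub_le_self _ (Nat.cast_nonneg _)
  · intro k hk
    dsimp only
    rw [hk, Nat.cast_zero, sub_zero, div_self hpos.ne']
  · intro k hk
    dsimp only
    rw [hk, Nat.cast_sub (by omega), Nat.cast_one, sub_self, zero_div]

end IsScoreVec

lemma sMinus1_bordaVec {m : ℕ} (hm : 4 ≤ m) : sMinus1 (bordaVec m) = bordaVec (m - 1) := by
  have hm' : (4 : ℝ) ≤ m := by exact_mod_cast hm
  have h1 : (m : ℝ) - 1 ≠ 0 := by linarith
  have h2 : (m : ℝ) - 1 - 1 ≠ 0 := by linarith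
  funext k
  have h3 : ((m : ℝ) - 1 - 1) / (m - 1) ≠ 0 := div_ne_zero h2 h1
  simp only [sMinus1, bordaVec, Nat.cast_one, if_neg h3]
  rw [Nat.cast_sub (by omega)]
  push_cast
  field_simp
  ring

lemma sMinusM_bordaVec {m : ℕ} (hm : 4 ≤ m) : sMinusM (bordaVec m) = bordaVec (m - 1) := by
  have hm' : (4 : ℝ) ≤ m := by exact_mod_cast hm
  have h1 : (m : ℝ) - 1 ≠ 0 := by linarith
  have h2 : (m : ℝ) - 1 - 1 ≠ 0 := by linarith
  have hc : ((m - 2 : ℕ) : ℝ) = m - 2 := by rw [Nat.cast_sub (by omega)]; norm_num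
  have hd : ((m - 1 : ℕ) : ℝ) = m - 1 := by rw [Nat.cast_sub (by omega)]; norm_num
  have h4 : 1 - ((m : ℝ) - 1 - (m - 2)) / (m - 1) = (m - 1 - 1) / (m - 1) := by
    field_simp
    ring
  have h3 : ((m : ℝ) - 1 - (m - 2)) / (m - 1) ≠ 1 := by
    intro h
    rw [h, sub_self] at h4
    exact div_ne_zero h2 h1 h4.symm
  funext k
  simp only [sMinusM, bordaVec, hc, hd, if_neg h3, h4]
  field_simp
  ring

lemma exists_eq_mul_of_sMinus1_eq {m : ℕ} (hm : 4 ≤ m) {h₁ : 1 < m} {s t : Fin m → ℝ}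
    (hs : s ⟨1, h₁⟩ ≠ 0) (ht : t ⟨1, h₁⟩ ≠ 0) (h : sMinus1 s = sMinus1 t) :
    ∃ c : ℝ, ∀ k : Fin m, 1 ≤ (k : ℕ) → (k : ℕ) ≤ m - 2 → s k = c * t k := by
  refine ⟨s ⟨1, h₁⟩ / t ⟨1, h₁⟩, fun k hk _ => ?_⟩
  have hlt := k.isLt
  have hj := congrFun h ⟨k - 1, by omega⟩
  simp only [sMinus1, if_neg hs, if_neg ht, Nat.sub_add_cancel hk, Fin.eta] at hj
  field_simp at hj ⊢
  linarith

lemma exists_one_sub_eq_mul_of_sMinusM_eq {m : ℕ} (hm : 4 ≤ m) {h₂ : m - 2 < m} {s t : Fin m → ℝ}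
    (hs : s ⟨m - 2, h₂⟩ ≠ 1) (ht : t ⟨m - 2, h₂⟩ ≠ 1) (h : sMinusM s = sMinusM t) :
    ∃ c : ℝ, ∀ k : Fin m, 1 ≤ (k : ℕ) → (k : ℕ) ≤ m - 2 → 1 - s k = c * (1 - t k) := by
  refine ⟨(1 - s ⟨m - 2, h₂⟩) / (1 - t ⟨m - 2, h₂⟩), fun k _ hk => ?_⟩
  have hj := congrFun h ⟨k, by omega⟩
  simp only [sMinusM, if_neg hs, if_neg ht, Fin.eta] at hj
  have hs' := sub_ne_zero.mpr hs.symm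
  have ht' := sub_ne_zero.mpr ht.symm
  field_simp at hj ⊢
  linarith

lemma midMean_eq_mul {m : ℕ} {s t : Fin m → ℝ} {c : ℝ}
    (h : ∀ k : Fin m, 1 ≤ (k : ℕ) → (k : ℕ) ≤ m - 2 → s k = c * t k) :
    midMean s = c * midMean t := by
  rw [midMean_congr h, midMean_const_mul]

lemma one_sub_midMean_eq_mul {m : ℕ} (hm : 4 ≤ m) {s t : Fin m → ℝ} {c : ℝ}
    (h : ∀ k : Fin m, 1 ≤ (k : ℕ) → (k : ℕ) ≤ m - 2 → 1 - s k = c * (1 - t k)) :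
    1 - midMean s = c * (1 - midMean t) := by
  rw [← midMean_one_sub hm s, ← midMean_one_sub hm t, midMean_congr h, midMean_const_mul]

/-- Proportional vectors with the same nonzero mean agree. -/
lemma IsScoreVec.eq_of_eq_mul {m : ℕ} {s t : Fin m → ℝ} (hs : IsScoreVec s)
    (ht : IsScoreVec t) {c : ℝ}
    (h : ∀ k : Fin m, 1 ≤ (k : ℕ) → (k : ℕ) ≤ m - 2 → s k = c * t k)
    (hst : midMean s = midMean t) (h0 : midMean t ≠ 0) : s = t := by
  have hM := midMean_eq_mul h
  rw [hst] at hM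
  have hc : c = 1 := by
    apply mul_right_cancel₀ h0
    linarith
  exact hs.ext_mid ht fun k h1 h2 => by rw [h k h1 h2, hc, one_mul]

/-- Vectors with proportional complements and the same mean, different from one, agree. -/
lemma IsScoreVec.eq_of_one_sub_eq_mul {m : ℕ} (hm : 4 ≤ m) {s t : Fin m → ℝ}
    (hs : IsScoreVec s) (ht : IsScoreVec t) {c : ℝ}
    (h : ∀ k : Fin m, 1 ≤ (k : ℕ) → (k : ℕ) ≤ m - 2 → 1 - s k = c * (1 - t k))
    (hst : midMean s = midMean t) (h1 : midMean t ≠ 1) : s = t := by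
  have hM := one_sub_midMean_eq_mul hm h
  rw [hst] at hM
  have hc : c = 1 := by
    apply mul_right_cancel₀ (sub_ne_zero.mpr h1.symm)
    linarith
  refine hs.ext_mid ht fun k h1 h2 => ?_
  have := h k h1 h2
  rw [hc] at this
  linarith

/-- If both `s`, `t` and their complements are proportional, then `s = t` or the middle entries
of `t` are constant. -/
lemma IsScoreVec.eq_or_mid_const {m : ℕ} {s t : Fin m → ℝ} (hs : IsScoreVec s)
    (ht : IsScoreVec t) {c d : ℝ}
    (hc : ∀ k : Fin m, 1 ≤ (k : ℕ) → (k : ℕ) ≤ m - 2 → s k = c * t k)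
    (hd : ∀ k : Fin m, 1 ≤ (k : ℕ) → (k : ℕ) ≤ m - 2 → 1 - s k = d * (1 - t k)) :
    s = t ∨ ∃ e, ∀ k : Fin m, 1 ≤ (k : ℕ) → (k : ℕ) ≤ m - 2 → t k = e := by
  have hcd (k : Fin m) (h1 : 1 ≤ (k : ℕ)) (h2 : (k : ℕ) ≤ m - 2) :
      (c - d) * t k = 1 - d := by
    linarith [hc k h1 h2, hd k h1 h2]
  by_cases hne : c = d
  · left
    refine hs.ext_mid ht fun k h1 h2 => ?_
    have h := hcd k h1 h2
    rw [hne, sub_self, zero_mul] at h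
    rw [hc k h1 h2, hne]
    linear_combination t k * h
  · right
    exact ⟨(1 - d) / (c - d), fun k h1 h2 =>
      (eq_div_iff (sub_ne_zero.mpr hne)).mpr (by linarith [hcd k h1 h2])⟩

lemma bordaVec_second_ne_penultimate {m : ℕ} (hm : 4 ≤ m) (h₁ : 1 < m) (h₂ : m - 2 < m) :
    bordaVec m ⟨1, h₁⟩ ≠ bordaVec m ⟨m - 2, h₂⟩ := by
  have hm' : (4 : ℝ) ≤ m := by exact_mod_cast hm
  have h1 : (m : ℝ) - 1 ≠ 0 := by linarith
  intro h
  simp only [bordaVec, Nat.cast_sub (by omega : 2 ≤ m)] at h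
  field_simp at h
  push_cast at h
  linarith

/-- If the middle entries of `s` are constant, their common value is the mean. -/
lemma eq_midMean_of_mid_const {m : ℕ} (hm : 4 ≤ m) {s : Fin m → ℝ} {e : ℝ}
    (h : ∀ k : Fin m, 1 ≤ (k : ℕ) → (k : ℕ) ≤ m - 2 → s k = e)
    (k : Fin m) (h1 : 1 ≤ (k : ℕ)) (h2 : (k : ℕ) ≤ m - 2) : s k = midMean s := by
  rw [midMean_congr h, midMean_const hm, h k h1 h2]

/-- Lemma (convolution): unless `s(2) = s(m-1) = 1/2` and `s'(2) = s'(m-1)`, one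
of the three reductions gives a pair of score vectors for fewer alternatives with
the required non-Borda and distinctness properties. -/
theorem convolution_lemma
    (m : ℕ) (hm : 4 ≤ m) (s s' : Fin m → ℝ)
    (hs : IsScoreVec s) (hs' : IsScoreVec s')
    (hsB : s ≠ bordaVec m) (hne : s' ≠ s)
    (hexc : ¬ (s ⟨1, by omega⟩ = 1/2 ∧ s ⟨m - 2, by omega⟩ = 1/2 ∧
               s' ⟨1, by omega⟩ = s' ⟨m - 2, by omega⟩)) :
    (IsScoreVec (sMinus1 s) ∧ IsScoreVec (sMinus1 s') ∧
      sMinus1 s ≠ bordaVec (m - 1) ∧ sMinus1 s ≠ sMinus1 s') ∨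
    (IsScoreVec (sMinusM s) ∧ IsScoreVec (sMinusM s') ∧
      sMinusM s ≠ bordaVec (m - 1) ∧ sMinusM s ≠ sMinusM s') ∨
    (IsScoreVec (sAve s) ∧ IsScoreVec (sAve s') ∧
      sAve s ≠ ![(1 : ℝ), 1/2, 0] ∧ sAve s ≠ sAve s') := by
  have hB : IsScoreVec (bordaVec m) := IsScoreVec.bordaVec hm
  have hMB : midMean (bordaVec m) = 1 / 2 := midMean_bordaVec hm
  have hB1 : bordaVec m ⟨1, by omega⟩ ≠ 0 := by
    rw [Ne, ← hB.midMean_eq_zero_iff hm, hMB]; norm_num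
  have hBm : bordaVec m ⟨m - 2, by omega⟩ ≠ 1 := by
    rw [Ne, ← hB.midMean_eq_one_iff hm, hMB]; norm_num
  by_contra! hcon
  obtain ⟨hi, hii, hiii⟩ := hcon
  -- Failure of each alternative, in terms of the mean of the middle entries.
  have hM : midMean s = 1 / 2 ∨ midMean s = midMean s' := by
    by_contra! hM
    refine hM.2 (congrFun (hiii (hs.sAve hm) (hs'.sAve hm) fun h => ?_) 1)
    exact hM.1 (congrFun h 1)
  have ha : s ⟨1, by omega⟩ ≠ 0 := by
    intro ha
    have h0 := (hs.midMean_eq_zero_iff hm).mpr ha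
    have ha' : s' ⟨1, by omega⟩ = 0 := by
      rw [← hs'.midMean_eq_zero_iff hm]
      rcases hM with h | h <;> linarith
    exact hne (hs'.ext_mid hs fun k hk _ => by
      rw [hs.eq_zero_of_second ha k hk, hs'.eq_zero_of_second ha' k hk])
  have hb : s ⟨m - 2, by omega⟩ ≠ 1 := by
    intro hb
    have h0 := (hs.midMean_eq_one_iff hm).mpr hb
    have hb' : s' ⟨m - 2, by omega⟩ = 1 := by
      rw [← hs'.midMean_eq_one_iff hm]
      rcases hM with h | h <;> linarith
    exact hne (hs'.ext_mid hs fun k _ hk => by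
      rw [hs.eq_one_of_penultimate hb k hk, hs'.eq_one_of_penultimate hb' k hk])
  have hM0 : midMean s ≠ 0 := fun h => ha ((hs.midMean_eq_zero_iff hm).mp h)
  have hM1 : midMean s ≠ 1 := fun h => hb ((hs.midMean_eq_one_iff hm).mp h)
  have hconst (e e' : ℝ) (hM : midMean s = 1 / 2)
      (h : ∀ k : Fin m, 1 ≤ (k : ℕ) → (k : ℕ) ≤ m - 2 → s k = e)
      (h' : ∀ k : Fin m, 1 ≤ (k : ℕ) → (k : ℕ) ≤ m - 2 → s' k = e') : False := by
    have h1 : 1 ≤ m - 2 := by omega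
    refine hexc ⟨?_, ?_, ?_⟩
    · rw [← hM]; exact eq_midMean_of_mid_const hm h _ le_rfl h1
    · rw [← hM]; exact eq_midMean_of_mid_const hm h _ h1 le_rfl
    · rw [h' _ le_rfl h1, h' _ h1 le_rfl]
  have hi' : s' ⟨1, by omega⟩ ≠ 0 → sMinus1 s = sMinus1 (bordaVec m) ∨ sMinus1 s = sMinus1 s' := by
    intro ha'
    rw [sMinus1_bordaVec hm]
    exact or_iff_not_imp_left.mpr (hi (hs.sMinus1 hm ha) (hs'.sMinus1 hm ha'))
  have hii' : s' ⟨m - 2, by omega⟩ ≠ 1 →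
      sMinusM s = sMinusM (bordaVec m) ∨ sMinusM s = sMinusM s' := by
    intro hb'
    rw [sMinusM_bordaVec hm]
    exact or_iff_not_imp_left.mpr (hii (hs.sMinusM hm hb) (hs'.sMinusM hm hb'))
  by_cases ha' : s' ⟨1, by omega⟩ = 0
  · have hz := hs'.eq_zero_of_second ha'
    have hhalf : midMean s = 1 / 2 :=
      hM.resolve_right fun h => hM0 (h.trans ((hs'.midMean_eq_zero_iff hm).mpr ha'))
    have hb' : s' ⟨m - 2, by omega⟩ ≠ 1 := by
      rw [hz _ (by dsimp only; omega)]; norm_num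
    rcases hii' hb' with h | h
    · obtain ⟨c, hc⟩ := exists_one_sub_eq_mul_of_sMinusM_eq hm hb hBm h
      exact hsB (hs.eq_of_one_sub_eq_mul hm hB hc (by rw [hhalf, hMB]) (by rw [hMB]; norm_num))
    · obtain ⟨c, hc⟩ := exists_one_sub_eq_mul_of_sMinusM_eq hm hb hb' h
      refine hconst (1 - c) 0 hhalf (fun k h1 h2 => ?_) fun k h1 _ => hz k h1
      have := hc k h1 h2
      rw [hz k h1] at this
      linarith
  by_cases hb' : s' ⟨m - 2, by omega⟩ = 1
  · have hz := hs'.eq_one_of_penultimate hb'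
    have hhalf : midMean s = 1 / 2 :=
      hM.resolve_right fun h => hM1 (h.trans ((hs'.midMean_eq_one_iff hm).mpr hb'))
    rcases hi' ha' with h | h
    · obtain ⟨c, hc⟩ := exists_eq_mul_of_sMinus1_eq hm ha hB1 h
      exact hsB (hs.eq_of_eq_mul hB hc (by rw [hhalf, hMB]) (by rw [hMB]; norm_num))
    · obtain ⟨c, hc⟩ := exists_eq_mul_of_sMinus1_eq hm ha ha' h
      refine hconst c 1 hhalf (fun k h1 h2 => ?_) fun k _ h2 => hz k h2
      rw [hc k h1 h2, hz k h2, mul_one]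
  have hM0' : midMean s' ≠ 0 := fun h => ha' ((hs'.midMean_eq_zero_iff hm).mp h)
  have hM1' : midMean s' ≠ 1 := fun h => hb' ((hs'.midMean_eq_one_iff hm).mp h)
  rcases hi' ha' with h | h <;> rcases hii' hb' with g | g
  · obtain ⟨c, hc⟩ := exists_eq_mul_of_sMinus1_eq hm ha hB1 h
    obtain ⟨d, hd⟩ := exists_one_sub_eq_mul_of_sMinusM_eq hm hb hBm g
    rcases hs.eq_or_mid_const hB hc hd with heq | ⟨e, he⟩
    · exact hsB heq
    · have h1 : 1 ≤ m - 2 := by omega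
      exact bordaVec_second_ne_penultimate hm (by omega) (by omega)
        ((he _ le_rfl h1).trans (he _ h1 le_rfl).symm)
  · obtain ⟨c, hc⟩ := exists_eq_mul_of_sMinus1_eq hm ha hB1 h
    obtain ⟨d, hd⟩ := exists_one_sub_eq_mul_of_sMinusM_eq hm hb hb' g
    rcases hM with hM | hM
    · exact hsB (hs.eq_of_eq_mul hB hc (by rw [hM, hMB]) (by rw [hMB]; norm_num))
    · exact hne (hs.eq_of_one_sub_eq_mul hm hs' hd hM hM1').symm
  · obtain ⟨c, hc⟩ := exists_eq_mul_of_sMinus1_eq hm ha ha' h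
    obtain ⟨d, hd⟩ := exists_one_sub_eq_mul_of_sMinusM_eq hm hb hBm g
    rcases hM with hM | hM
    · exact hsB (hs.eq_of_one_sub_eq_mul hm hB hd (by rw [hM, hMB]) (by rw [hMB]; norm_num))
    · exact hne (hs.eq_of_eq_mul hs' hc hM hM0').symm
  · obtain ⟨c, hc⟩ := exists_eq_mul_of_sMinus1_eq hm ha ha' h
    obtain ⟨d, hd⟩ := exists_one_sub_eq_mul_of_sMinusM_eq hm hb hb' g
    rcases hM with hM | hM
    · rcases hs.eq_or_mid_const hs' hc hd with heq | ⟨e, he⟩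
      · exact hne heq.symm
      · exact hconst (c * e) e hM (fun k h1 h2 => by rw [hc k h1 h2, he k h1 h2]) he
    · exact hne (hs.eq_of_eq_mul hs' hc hM hM0').symm
end
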